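/- arXiv:math/0302076 — 5 statements merged into one kernel-verified Lean document; each statement's English description precedes it below -/
import Mathlib

section
/- For the symmetric stationary nearest-neighbor random walk on ℤ^d with transition probabilities s(e_i)=s(-e_i) ≥ κ₀ > 0 and 2Σᵢs(e_i)=1, and any ε > 0, there exists a constant C_ε depending only on κ₀ and d such that for all n ≥ 1 and all unit vectors e ∈ {±e₁,…,±e_d}: Σ_{z∈ℤ^d} |p_{n+1}(0,z) - p_n(e,z)| ≤ C_ε n^{-1/2+ε}, where p_n denotes the n-step transition probability. -/
open Finset

abbrev MA (d : ℕ) := AddMonoidAlgebra ℝ (Fin d → ℤ)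

noncomputable def N1 {d : ℕ} (f : MA d) : ℝ := ∑' z, |f.coeff z|

lemma N1_summable {d : ℕ} (f : MA d) : Summable (fun z => |f.coeff z|) := by
  apply summable_of_hasFiniteSupport
  refine (Finset.finite_toSet f.coeff.support).subset ?_
  intro z hz
  simpa using hz

lemma N1_nonneg {d : ℕ} (f : MA d) : 0 ≤ N1 f := tsum_nonneg fun _ => abs_nonneg _

lemma N1_add {d : ℕ} (f g : MA d) : N1 (f + g) ≤ N1 f + N1 g := by
  unfold N1
  rw [← (N1_summable f).tsum_add (N1_summable g)]
  exact (N1_summable _).tsum_le_tsum (fun z => abs_add_le _ _) ((N1_summable f).add (N1_summable g))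

lemma N1_zero {d : ℕ} : N1 (0 : MA d) = 0 := by simp [N1]

lemma N1_sum {d : ℕ} {ι : Type*} (t : Finset ι) (f : ι → MA d) :
    N1 (∑ i ∈ t, f i) ≤ ∑ i ∈ t, N1 (f i) := by
  classical
  induction t using Finset.induction_on with
  | empty => simp [N1_zero]
  | insert a t ha ih =>
    rw [Finset.sum_insert ha, Finset.sum_insert ha]
    exact (N1_add _ _).trans (by linarith)

lemma N1_single_mul {d : ℕ} (a : Fin d → ℤ) (r : ℝ) (f : MA d) :
    N1 (AddMonoidAlgebra.single a r * f) = |r| * N1 f := by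
  unfold N1
  rw [← tsum_mul_left, ← (Equiv.addLeft (-a)).tsum_eq (fun z => |r| * |f.coeff z|)]
  refine tsum_congr fun z => ?_
  rw [AddMonoidAlgebra.coeff_single_mul_apply, abs_mul]
  rfl

lemma N1_smul {d : ℕ} (r : ℝ) (f : MA d) : N1 (r • f) = |r| * N1 f := by
  unfold N1
  rw [← tsum_mul_left]
  refine tsum_congr fun z => ?_
  rw [← abs_mul]; rfl

lemma N1_one {d : ℕ} : N1 (1 : MA d) = 1 := by
  unfold N1
  rw [AddMonoidAlgebra.one_def, tsum_eq_single 0]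
  · simp
  · intro b hb
    simp [Finsupp.single_apply, hb.symm]

lemma N1_single {d : ℕ} (a : Fin d → ℤ) (r : ℝ)  :
    N1 (AddMonoidAlgebra.single a r : MA d) = |r| := by
  have := N1_single_mul a r (1 : MA d)
  rwa [mul_one, N1_one, mul_one] at this

lemma N1_mul {d : ℕ} (f g : MA d) : N1 (f * g) ≤ N1 f * N1 g := by
  have key : N1 f = ∑ z ∈ f.coeff.support, |f.coeff z| := by
    unfold N1
    apply tsum_eq_sum
    intro z hz
    simpa using hz
  have hf : f = ∑ z ∈ f.coeff.support, AddMonoidAlgebra.single z (f.coeff z) := by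
    conv_lhs => rw [← AddMonoidAlgebra.sum_coeff_single f]
    rfl
  rw [key, Finset.sum_mul]
  conv_lhs => rw [hf, Finset.sum_mul]
  refine (N1_sum _ _).trans (Finset.sum_le_sum fun z _ => ?_)
  rw [N1_single_mul]

lemma N1_pow {d : ℕ} (f : MA d) (n : ℕ) : N1 (f ^ n) ≤ N1 f ^ n := by
  induction n with
  | zero => simp [N1_one]
  | succ n ih =>
    rw [pow_succ, pow_succ]
    exact (N1_mul _ _).trans (mul_le_mul_of_nonneg_right ih (N1_nonneg _))

lemma euler {R : Type*} [CommRing R] [Algebra ℝ R] (A B : R) (m : ℕ) :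
    ∑ j ∈ range (m + 1 + 1), (((2 * j - (m + 1)) * ((m + 1).choose j : ℝ) : ℝ)) •
      (A ^ j * B ^ (m + 1 - j)) = (m + 1 : ℝ) • ((A + B) ^ m * (A - B)) := by
  have h1 : ∑ j ∈ range (m + 1 + 1), ((j * ((m + 1).choose j : ℝ) : ℝ)) •
      (A ^ j * B ^ (m + 1 - j)) = (m + 1 : ℝ) • ((A + B) ^ m * A) := by
    rw [sum_range_succ', add_pow, sum_mul, smul_sum]
    simp only [Nat.cast_zero, zero_mul, zero_smul, add_zero]
    refine sum_congr rfl fun j _ => ?_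
    have : ((j + 1 : ℕ) : ℝ) * ((m + 1).choose (j + 1) : ℝ) = (m + 1) * (m.choose j : ℝ) := by
      have := Nat.add_one_mul_choose_eq m j
      rw [mul_comm]
      exact_mod_cast this.symm
    rw [this, Nat.add_sub_add_right, mul_smul, ← map_natCast (algebraMap ℝ R),
      Algebra.smul_def (m.choose j : ℝ)]
    congr 1
    ring
  have h2 : ∑ j ∈ range (m + 1 + 1), (((m + 1 - j) * ((m + 1).choose j : ℝ) : ℝ)) •
      (A ^ j * B ^ (m + 1 - j)) = (m + 1 : ℝ) • ((A + B) ^ m * B) := by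
    rw [sum_range_succ, add_pow, sum_mul, smul_sum]
    have : ((m : ℝ) + 1 - (m + 1 : ℕ)) = 0 := by push_cast; ring
    rw [this]
    simp only [zero_mul, zero_smul, add_zero]
    refine sum_congr rfl fun j hj => ?_
    have hj : j ≤ m := by simpa [Nat.lt_succ_iff] using hj
    have : ((m : ℝ) + 1 - j) * ((m + 1).choose j : ℝ) = (m + 1) * (m.choose j : ℝ) := by
      have := Nat.choose_mul_succ_eq m j
      have h3 : ((m + 1 - j : ℕ) : ℝ) = m + 1 - j := by
        rw [Nat.cast_sub (by omega)]; push_cast; ring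
      rw [← h3, mul_comm, mul_comm ((m:ℝ) + 1)]
      exact_mod_cast this.symm
    rw [this, mul_smul, ← map_natCast (algebraMap ℝ R),
      Algebra.smul_def (m.choose j : ℝ)]
    congr 1
    rw [show m + 1 - j = (m - j) + 1 by omega]
    ring
  rw [mul_sub, smul_sub, ← h1, ← h2, ← sum_sub_distrib]
  refine sum_congr rfl fun j _ => ?_
  rw [← sub_smul]
  congr 1
  ring

lemma var_half (m : ℕ) :
    ∑ j ∈ range (m + 1), (2 * (j:ℝ) - m) ^ 2 * (m.choose j : ℝ) = (m:ℝ) * 2 ^ m := by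
  have h := congrArg (Polynomial.eval (1 / 2 : ℝ)) (bernsteinPolynomial.variance ℝ m)
  rw [Polynomial.eval_finsetSum] at h
  have h2 : ∀ j ∈ range (m + 1), Polynomial.eval (1 / 2 : ℝ)
      ((m • Polynomial.X - (j : Polynomial ℝ)) ^ 2 * bernsteinPolynomial ℝ m j)
      = ((2 * (j:ℝ) - m) ^ 2 * (m.choose j : ℝ)) * ((1 / 2) ^ m * (1 / 4)) := by
    intro j hj
    have hj : j ≤ m := by simpa [Nat.lt_succ_iff] using hj
    have : (1 / 2 : ℝ) ^ m = (1 / 2) ^ j * (1 / 2) ^ (m - j) := by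
      rw [← pow_add]; congr 1; omega
    rw [this]
    simp only [bernsteinPolynomial, Polynomial.eval_mul, Polynomial.eval_pow, Polynomial.eval_sub,
      Polynomial.eval_smul, Polynomial.eval_X, Polynomial.eval_natCast, Polynomial.eval_one,
      nsmul_eq_mul]
    rw [show (1 - 1 / 2 : ℝ) = 1 / 2 by norm_num]
    ring
  rw [sum_congr rfl h2, ← sum_mul] at h
  simp only [Polynomial.eval_mul, Polynomial.eval_sub,
      Polynomial.eval_X, Polynomial.eval_natCast, Polynomial.eval_one, nsmul_eq_mul] at h
  have h3 : (1 / 2 : ℝ) ^ m * 2 ^ m = 1 := by rw [← mul_pow]; norm_num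
  generalize (∑ i ∈ range (m + 1), (2 * (i:ℝ) - ↑m) ^ 2 * ↑(m.choose i)) = S at *
  calc S = (S * ((1 / 2) ^ m * (1 / 4))) * (4 * 2 ^ m) := by
        linear_combination (-S) * h3
    _ = _ := by rw [h]; ring

lemma abs_half (m : ℕ) (hm : 0 < m) :
    ∑ j ∈ range (m + 1), |2 * (j:ℝ) - m| * (m.choose j : ℝ) ≤ √m * 2 ^ m := by
  have hs : 0 < √(m : ℝ) := Real.sqrt_pos.2 (by exact_mod_cast hm)
  have hss : √(m : ℝ) * √m = m := Real.mul_self_sqrt (by positivity)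
  have h1 : ∑ j ∈ range (m + 1), (m.choose j : ℝ) = 2 ^ m := by
    exact_mod_cast Nat.sum_range_choose m
  have : ∀ x : ℝ, |x| ≤ (√m + x ^ 2 / √m) / 2 := by
    intro x
    have : √(m : ℝ) + x ^ 2 / √m = (√m ^ 2 + |x| ^ 2) / √m := by
      rw [sq_abs]; field_simp
    rw [this, div_div, le_div_iff₀ (by positivity)]
    nlinarith [sq_nonneg (√m - |x|)]
  calc _ ≤ ∑ j ∈ range (m + 1), ((√m / 2) * (m.choose j : ℝ)
            + (1 / (2 * √m)) * ((2 * (j:ℝ) - m) ^ 2 * (m.choose j : ℝ))) := by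
        refine sum_le_sum fun j _ => ?_
        calc _ ≤ ((√m + (2 * (j:ℝ) - m) ^ 2 / √m) / 2) * (m.choose j : ℝ) :=
              mul_le_mul_of_nonneg_right (this _) (by positivity)
          _ = _ := by field_simp
    _ = √m * 2 ^ m := by
        rw [sum_add_distrib, ← mul_sum, ← mul_sum, h1, var_half]
        nth_rw 3 [← hss]
        field_simp
        norm_num

lemma core {d : ℕ} (a b : Fin d → ℤ) (k : ℕ) :
    N1 (((AddMonoidAlgebra.single a 1 + AddMonoidAlgebra.single b 1) ^ k *
      (AddMonoidAlgebra.single a 1 - AddMonoidAlgebra.single b 1) : MA d))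
      ≤ 2 ^ (k + 1) / √(k + 1) := by
  set A : MA d := AddMonoidAlgebra.single a 1
  set B : MA d := AddMonoidAlgebra.single b 1
  have hk : (0 : ℝ) < k + 1 := by positivity
  have hs : 0 < √(k + 1 : ℝ) := Real.sqrt_pos.2 hk
  have hss : √(k + 1 : ℝ) * √(k + 1) = k + 1 := Real.mul_self_sqrt hk.le
  have hAB : ∀ i j : ℕ, N1 (A ^ i * B ^ j) = 1 := by
    intro i j
    simp only [A, B, AddMonoidAlgebra.single_pow, one_pow]
    rw [N1_single_mul, N1_single]; simp
  have h := congrArg N1 (euler A B k)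
  rw [N1_smul, abs_of_pos hk] at h
  have h2 : (k + 1 : ℝ) * N1 ((A + B) ^ k * (A - B)) ≤ √(k + 1) * 2 ^ (k + 1) := by
    rw [← h]
    refine (N1_sum _ _).trans ?_
    have h3 := abs_half (k + 1) (by omega)
    push_cast at h3
    refine le_trans (le_of_eq (sum_congr rfl fun j _ => ?_)) h3
    rw [N1_smul, hAB, mul_one, abs_mul, Nat.abs_cast]
  rw [le_div_iff₀ hs]
  have h3 : √(k + 1 : ℝ) * (N1 ((A + B) ^ k * (A - B)) * √(k + 1)) ≤ √(k + 1) * 2 ^ (k + 1) := by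
    refine le_trans (le_of_eq ?_) h2
    linear_combination N1 ((A + B) ^ k * (A - B)) * hss
  exact le_of_mul_le_mul_left h3 hs

lemma inv_moment (a b : ℝ) (ha : 0 < a) (hb : 0 ≤ b) (hab : a + b = 1) (n : ℕ) :
    ∑ k ∈ range (n + 1), a ^ k * b ^ (n - k) * (n.choose k : ℝ) * (1 / (k + 1)) ≤ 1 / (a * (n + 1)) := by
  have h : ∑ k ∈ range (n + 1 + 1), a ^ k * b ^ (n + 1 - k) * ((n + 1).choose k : ℝ) = 1 := by
    rw [← add_pow, hab, one_pow]
  rw [sum_range_succ'] at h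
  rw [le_div_iff₀ (by positivity)]
  have h0 : 0 ≤ a ^ 0 * b ^ (n + 1 - 0) * ((n + 1).choose 0 : ℝ) := by positivity
  refine le_trans (le_of_eq ?_) (h.le.trans' (le_add_of_nonneg_right h0))
  rw [sum_mul]
  refine sum_congr rfl fun k _ => ?_
  have : ((n + 1).choose (k + 1) : ℝ) * (k + 1) = (n + 1) * (n.choose k : ℝ) := by
    exact_mod_cast (Nat.add_one_mul_choose_eq n k).symm
  rw [Nat.add_sub_add_right]
  field_simp
  rw [pow_succ]
  linear_combination (-(a ^ k * b ^ (n - k) * a)) * this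

lemma sqrt_moment (a b : ℝ) (ha : 0 < a) (hb : 0 ≤ b) (hab : a + b = 1) (n : ℕ) (hn : 0 < n) :
    ∑ k ∈ range (n + 1), a ^ k * b ^ (n - k) * (n.choose k : ℝ) * (1 / √(k + 1))
      ≤ (1 / a + 1) / 2 / √n := by
  have hn' : (0 : ℝ) < n := by exact_mod_cast hn
  have hs : 0 < √(n : ℝ) := Real.sqrt_pos.2 hn'
  have hss : √(n : ℝ) * √n = n := Real.mul_self_sqrt (by positivity)
  have hT : ∑ k ∈ range (n + 1), a ^ k * b ^ (n - k) * (n.choose k : ℝ) = 1 := by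
    rw [← add_pow, hab, one_pow]
  have hI := inv_moment a b ha hb hab n
  have hI2 : 1 / (a * (n + 1 : ℝ)) ≤ 1 / (a * n) := by
    apply one_div_le_one_div_of_le (by positivity)
    nlinarith
  have key : ∀ k : ℕ, 1 / √(k + 1 : ℝ) ≤ (√n / 2) * (1 / (k + 1)) + 1 / (2 * √n) := by
    intro k
    have hk : (0 : ℝ) < k + 1 := by positivity
    have h1 : 1 / (k + 1 : ℝ) = (1 / √(k + 1 : ℝ)) ^ 2 := by
      rw [div_pow, Real.sq_sqrt hk.le, one_pow]
    rw [h1]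
    generalize 1 / √(k + 1 : ℝ) = x
    have : (√n / 2) * x ^ 2 + 1 / (2 * √n) - x = (√n * x - 1) ^ 2 / (2 * √n) := by
      field_simp; ring
    have : 0 ≤ (√n * x - 1) ^ 2 / (2 * √n) := by positivity
    linarith
  calc _ ≤ ∑ k ∈ range (n + 1), ((√n / 2) * (a ^ k * b ^ (n - k) * (n.choose k : ℝ) * (1 / (k + 1)))
          + (1 / (2 * √n)) * (a ^ k * b ^ (n - k) * (n.choose k : ℝ))) := by
        refine sum_le_sum fun k _ => ?_
        have := mul_le_mul_of_nonneg_left (key k)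
          (show 0 ≤ a ^ k * b ^ (n - k) * (n.choose k : ℝ) by positivity)
        linarith
    _ ≤ (√n / 2) * (1 / (a * n)) + 1 / (2 * √n) := by
        rw [sum_add_distrib, ← mul_sum, ← mul_sum, hT, mul_one]
        gcongr
        exact hI.trans hI2
    _ = _ := by
        nth_rw 2 [← hss]
        field_simp

lemma pow_bound {d : ℕ} (a b : Fin d → ℤ) (κ : ℝ) (hκ : 0 < κ) (hκ2 : 2 * κ ≤ 1) (Q : MA d)
    (hQ : N1 Q ≤ 1 - 2 * κ) (n : ℕ) (hn : 0 < n) :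
    N1 ((κ • (AddMonoidAlgebra.single a 1 + AddMonoidAlgebra.single b 1) + Q) ^ n *
      (AddMonoidAlgebra.single a 1 - AddMonoidAlgebra.single b 1) : MA d)
      ≤ (1 / (2 * κ) + 1) / √n := by
  have hc := core a b
  set A : MA d := AddMonoidAlgebra.single a 1
  set B : MA d := AddMonoidAlgebra.single b 1
  have hm := sqrt_moment (2 * κ) (1 - 2 * κ) (by linarith) (by linarith) (by ring) n hn
  rw [add_pow, sum_mul]
  refine (N1_sum _ _).trans ?_
  calc _ ≤ ∑ k ∈ range (n + 1), 2 * ((2 * κ) ^ k * (1 - 2 * κ) ^ (n - k) * (n.choose k : ℝ) * (1 / √(k + 1))) := by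
        refine sum_le_sum fun k _ => ?_
        have : (κ • (A + B)) ^ k * Q ^ (n - k) * (n.choose k : MA d) * (A - B)
            = (κ ^ k * (n.choose k : ℝ)) • (((A + B) ^ k * (A - B)) * Q ^ (n - k)) := by
          rw [smul_pow, mul_smul, Nat.cast_smul_eq_nsmul, nsmul_eq_mul]
          simp only [smul_mul_assoc]
          congr 1
          ring
        rw [this, N1_smul, abs_of_nonneg (by positivity)]
        have hq : N1 (Q ^ (n - k)) ≤ (1 - 2 * κ) ^ (n - k) :=
          (N1_pow _ _).trans (pow_le_pow_left₀ (N1_nonneg _) hQ _)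
        calc _ ≤ (κ ^ k * (n.choose k : ℝ)) * ((2 ^ (k + 1) / √(k + 1)) * (1 - 2 * κ) ^ (n - k)) := by
              refine mul_le_mul_of_nonneg_left ((N1_mul _ _).trans ?_) (by positivity)
              exact mul_le_mul (hc k) hq (N1_nonneg _) (by positivity)
          _ = _ := by rw [mul_pow]; ring
    _ ≤ 2 * ((1 / (2 * κ) + 1) / 2 / √n) := by
        rw [← mul_sum]; linarith
    _ = _ := by ring

noncomputable def unitv {d : ℕ} (v : Fin d × Bool) : Fin d → ℤ := Pi.single v.1 (if v.2 then 1 else -1)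

noncomputable def stepP {d : ℕ} (s : Fin d → ℝ) : MA d :=
  ∑ v : Fin d × Bool, s v.1 • AddMonoidAlgebra.single (unitv v) 1

lemma step_bound {d : ℕ} (s : Fin d → ℝ) (κ : ℝ) (hκ : 0 < κ) (hs : ∀ i, κ ≤ s i)
    (h1 : 2 * ∑ i, s i = 1) (v w : Fin d × Bool) (n : ℕ) (hn : 0 < n) :
    N1 (stepP s ^ n * (AddMonoidAlgebra.single (unitv v) 1 - AddMonoidAlgebra.single (unitv w) 1))
      ≤ (1 / (2 * κ) + 1) / √n := by
  classical
  by_cases hvw : v = w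
  · subst hvw
    rw [sub_self, mul_zero, N1_zero]
    positivity
  have hsum : ∑ u : Fin d × Bool, s u.1 = 1 := by
    rw [Fintype.sum_prod_type, ← h1, mul_sum]
    exact sum_congr rfl fun i _ => by simp [two_mul]
  set c : Fin d × Bool → ℝ := fun u => s u.1 - (if u = v then κ else 0) - (if u = w then κ else 0)
  have hc : ∀ u, 0 ≤ c u := by
    intro u
    have := hs u.1
    simp only [c]
    split_ifs with h h'
    · exact absurd (h.symm.trans h') hvw
    all_goals linarith
  have hcs : ∑ u, c u = 1 - 2 * κ := by
    simp only [c, sum_sub_distrib, hsum]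
    simp
    ring
  set Q : MA d := ∑ u, c u • AddMonoidAlgebra.single (unitv u) 1
  have hQ : N1 Q ≤ 1 - 2 * κ := by
    rw [← hcs]
    refine (N1_sum _ _).trans (sum_le_sum fun u _ => ?_)
    rw [N1_smul, N1_single, abs_of_nonneg (hc u)]
    simp
  have hP : stepP s = κ • (AddMonoidAlgebra.single (unitv v) 1 + AddMonoidAlgebra.single (unitv w) 1) + Q := by
    simp only [Q, c, sub_smul, sum_sub_distrib, stepP, ite_smul, zero_smul]
    simp only [sum_ite_eq', mem_univ, if_true, smul_add]
    abel
  rw [hP]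
  refine pow_bound _ _ κ hκ ?_ Q hQ n hn
  have := N1_nonneg Q
  linarith

lemma q_eq {d : ℕ} (s : Fin d → ℝ) (q : ℕ → (Fin d → ℤ) → (Fin d → ℤ) → ℝ)
    (h0 : ∀ z z', q 0 z z' = if z = z' then 1 else 0)
    (hq : ∀ n z z', q (n + 1) z z' =
          ∑ i, s i * (q n (z + Pi.single i 1) z' + q n (z - Pi.single i 1) z')) (n : ℕ) :
    ∀ z z', q n z z' = (stepP s ^ n).coeff (z' - z) := by
  induction n with
  | zero =>
    intro z z'
    rw [h0, pow_zero, AddMonoidAlgebra.one_def]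
    simp [Finsupp.single_apply, sub_eq_zero, eq_comm]
  | succ n ih =>
    intro z z'
    rw [hq, pow_succ']
    conv_rhs => rw [stepP, sum_mul]
    rw [AddMonoidAlgebra.coeff_sum, Finsupp.finsetSum_apply, Fintype.sum_prod_type]
    refine sum_congr rfl fun i _ => ?_
    rw [ih, ih]
    simp only [Fintype.sum_bool, smul_mul_assoc, AddMonoidAlgebra.coeff_smul, Finsupp.smul_apply,
      AddMonoidAlgebra.coeff_single_mul_apply, smul_eq_mul, one_mul, unitv, if_true]
    rw [mul_add]
    simp only [Bool.false_eq_true, if_false, Pi.single_neg]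
    congr 3
    · abel_nf
    · abel_nf

theorem stmt7 (d : ℕ) (hd : 0 < d) (κ₀ : ℝ) (hκ : 0 < κ₀) (ε : ℝ) (hε : 0 < ε) :
    ∃ C : ℝ, 0 < C ∧
      ∀ (s : Fin d → ℝ), (∀ i, κ₀ ≤ s i) → (2 * ∑ i, s i = 1) →
      ∀ q : ℕ → (Fin d → ℤ) → (Fin d → ℤ) → ℝ,
        (∀ z z', q 0 z z' = if z = z' then 1 else 0) →
        (∀ n z z', q (n + 1) z z' =
          ∑ i, s i * (q n (z + Pi.single i 1) z' + q n (z - Pi.single i 1) z')) →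
        ∀ n : ℕ, 1 ≤ n → ∀ (i : Fin d) (σ : Bool),
          ∑' z : Fin d → ℤ,
              |q (n + 1) 0 z - q n (Pi.single i (if σ then 1 else -1)) z|
            ≤ C * (n : ℝ) ^ (-(1 / 2 : ℝ) + ε) := by
  refine ⟨1 / (2 * κ₀) + 1, by positivity, ?_⟩
  intro s hs h1 q h0 hq n hn i σ
  have hn' : (1 : ℝ) ≤ n := by exact_mod_cast hn
  have hsum : ∑ u : Fin d × Bool, s u.1 = 1 := by
    rw [Fintype.sum_prod_type, ← h1, mul_sum]
    exact sum_congr rfl fun i _ => by simp [two_mul]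
  have e1 : ∑' z : Fin d → ℤ, |q (n + 1) 0 z - q n (Pi.single i (if σ then 1 else -1)) z|
      = N1 (stepP s ^ (n + 1) - AddMonoidAlgebra.single (unitv (i, σ)) 1 * stepP s ^ n) := by
    unfold N1
    refine tsum_congr fun z => ?_
    rw [q_eq s q h0 hq, q_eq s q h0 hq, AddMonoidAlgebra.coeff_sub, Finsupp.sub_apply,
      AddMonoidAlgebra.coeff_single_mul_apply, one_mul, sub_zero, sub_eq_neg_add z]
    rfl
  have e2 : stepP s ^ (n + 1) - AddMonoidAlgebra.single (unitv (i, σ)) 1 * stepP s ^ n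
      = ∑ u : Fin d × Bool, s u.1 • (stepP s ^ n * (AddMonoidAlgebra.single (unitv u) 1 -
          AddMonoidAlgebra.single (unitv (i, σ)) 1)) := by
    simp only [mul_sub, smul_sub, sum_sub_distrib]
    rw [← sum_smul, hsum, one_smul, pow_succ, mul_comm (AddMonoidAlgebra.single _ _)]
    congr 1
    generalize stepP s ^ n = X
    rw [stepP, mul_sum]
    simp only [mul_smul_comm]
  rw [e1, e2]
  calc _ ≤ ∑ u : Fin d × Bool, s u.1 * ((1 / (2 * κ₀) + 1) / √n) := by
        refine (N1_sum _ _).trans (sum_le_sum fun u _ => ?_)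
        have hsu : 0 ≤ s u.1 := hκ.le.trans (hs _)
        rw [N1_smul, abs_of_nonneg hsu]
        exact mul_le_mul_of_nonneg_left (step_bound s κ₀ hκ hs h1 u _ n hn) hsu
    _ = (1 / (2 * κ₀) + 1) * (n : ℝ) ^ (-(1 / 2 : ℝ)) := by
        rw [← sum_mul, hsum, one_mul, Real.rpow_neg (by positivity), ← Real.sqrt_eq_rpow]
        rfl
    _ ≤ _ := by
        apply mul_le_mul_of_nonneg_left _ (by positivity)
        exact Real.rpow_le_rpow_of_exponent_le hn' (by linarith)
end

section
/- Pointwise local-CLT-type difference bound: for the symmetric walk above there is a constant C depending only on κ₀ and d such that for all n, all i ∈ {1,…,d}, and all z ∈ ℤ^d with n+1 and Σⱼ zⱼ of the same parity: |p_{n+1}(0,z) - p_n(±e_i,z)| ≤ C (1 + |z_i|) n^{-(d+2)/2} + C ρⁿ for some ρ < 1 depending only on κ₀, d. -/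
open MeasureTheory Real

noncomputable section

/-- one-dimensional frequency measure -/
def muT : Measure ℝ := volume.restrict (Set.Ioc (-π) π)

instance : IsFiniteMeasure muT := by
  unfold muT; infer_instance

lemma muT_univ : muT.real Set.univ = 2 * π := by
  simp [muT, Measure.real]
  rw [ENNReal.toReal_ofReal] <;> nlinarith [pi_pos]

/-- frequency measure on the torus -/
def PT (d : ℕ) : Measure (Fin d → ℝ) := Measure.pi (fun _ => muT)

instance (d : ℕ) : IsFiniteMeasure (PT d) := by
  unfold PT; infer_instance

lemma PT_univ (d : ℕ) : (PT d).real Set.univ = (2 * π) ^ d := by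
  have h := muT_univ
  simp only [Measure.real] at h ⊢
  simp [PT, Measure.pi_univ, h]

/-- characteristic function -/
def phiT {d : ℕ} (s : Fin d → ℝ) (t : Fin d → ℝ) : ℝ := 2 * ∑ j, s j * cos (t j)

lemma int_cos (m : ℤ) : ∫ x, cos ((m : ℝ) * x) ∂muT = if m = 0 then 2 * π else 0 := by
  unfold muT
  rw [← intervalIntegral.integral_of_le (by linarith [pi_pos])]
  split_ifs with h
  · subst h; simp; ring
  · have hm : (m : ℝ) ≠ 0 := by exact_mod_cast h
    rw [intervalIntegral.integral_comp_mul_left (f := cos) (hc := hm)]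
    simp [Real.sin_int_mul_pi]

lemma integrable_of_cont_bdd {d : ℕ} {f : (Fin d → ℝ) → ℝ} (hf : Continuous f) (B : ℝ)
    (hB : ∀ t, |f t| ≤ B) : Integrable f (PT d) :=
  Integrable.of_bound hf.aestronglyMeasurable B (Filter.Eventually.of_forall hB)

lemma abs_prod_cos_le {d : ℕ} (S : Finset (Fin d)) (w : Fin d → ℤ) (t : Fin d → ℝ) :
    |∏ j ∈ S, cos ((w j : ℝ) * t j)| ≤ 1 := by
  rw [Finset.abs_prod]
  exact Finset.prod_le_one (fun _ _ => abs_nonneg _) (fun _ _ => abs_cos_le_one _)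

lemma abs_phiT_le_one {d : ℕ} (s : Fin d → ℝ) (hs : ∀ i, 0 ≤ s i) (h1 : 2 * ∑ i, s i = 1)
    (t : Fin d → ℝ) : |phiT s t| ≤ 1 := by
  unfold phiT
  rw [abs_mul, abs_two, ← h1]
  gcongr
  refine (Finset.abs_sum_le_sum_abs _ _).trans (Finset.sum_le_sum fun i _ => ?_)
  rw [abs_mul, abs_of_nonneg (hs i)]
  exact mul_le_of_le_one_right (hs i) (abs_cos_le_one _)

lemma phiT_cont {d : ℕ} (s : Fin d → ℝ) : Continuous (phiT s) := by
  unfold phiT; fun_prop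

lemma integrable_main {d : ℕ} (s : Fin d → ℝ) (hs : ∀ i, 0 ≤ s i) (h1 : 2 * ∑ i, s i = 1)
    (n : ℕ) (w : Fin d → ℤ) :
    Integrable (fun t => phiT s t ^ n * ∏ j, cos ((w j : ℝ) * t j)) (PT d) := by
  have := phiT_cont s
  refine integrable_of_cont_bdd (by fun_prop) 1 fun t => ?_
  rw [abs_mul, abs_pow]
  exact mul_le_one₀ (pow_le_one₀ (abs_nonneg _) (abs_phiT_le_one s hs h1 t)) (abs_nonneg _)
    (abs_prod_cos_le _ _ _)

lemma prod_shift {d : ℕ} (w : Fin d → ℤ) (i : Fin d) (c : ℤ) (t : Fin d → ℝ) :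
    ∏ j, cos ((((w + Pi.single i c : Fin d → ℤ) j : ℤ) : ℝ) * t j)
      = cos (((w i : ℝ) + c) * t i) * ∏ j ∈ Finset.univ.erase i, cos ((w j : ℝ) * t j) := by
  rw [← Finset.mul_prod_erase _ _ (Finset.mem_univ i)]
  congr 1
  · simp
  · refine Finset.prod_congr rfl fun j hj => ?_
    have : j ≠ i := (Finset.mem_erase.mp hj).1
    simp [this]

lemma fourier_rep {d : ℕ} (s : Fin d → ℝ) (hs : ∀ i, 0 ≤ s i) (h1 : 2 * ∑ i, s i = 1)
    (q : ℕ → (Fin d → ℤ) → (Fin d → ℤ) → ℝ)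
    (h0 : ∀ z z', q 0 z z' = if z = z' then 1 else 0)
    (hq : ∀ n z z', q (n + 1) z z' =
          ∑ i, s i * (q n (z + Pi.single i 1) z' + q n (z - Pi.single i 1) z')) (n : ℕ) :
    ∀ x z, (2 * π) ^ d * q n x z =
      ∫ t, phiT s t ^ n * ∏ j, cos ((((z - x) j : ℤ) : ℝ) * t j) ∂(PT d) := by
  induction n with
  | zero =>
    intro x z
    simp only [pow_zero, one_mul]
    unfold PT
    rw [integral_fintype_prod_eq_prod (𝕜 := ℝ) (f := fun j y => cos ((((z - x) j : ℤ) : ℝ) * y))]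
    simp_rw [int_cos, h0]
    split_ifs with h
    · subst h; simp
    · obtain ⟨j, hj⟩ := Function.ne_iff.mp h
      rw [Finset.prod_eq_zero (Finset.mem_univ j)]
      · simp
      · rw [if_neg]; simp [sub_eq_zero]; exact fun h => hj h.symm
  | succ n ih =>
    intro x z
    rw [hq, Finset.mul_sum]
    have : ∀ i, (2 * π) ^ d * (s i * (q n (x + Pi.single i 1) z + q n (x - Pi.single i 1) z))
        = ∫ t, s i * (phiT s t ^ n * ∏ j, cos ((((z - (x + Pi.single i 1) : Fin d → ℤ) j : ℤ) : ℝ) * t j)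
            + phiT s t ^ n * ∏ j, cos ((((z - (x - Pi.single i 1) : Fin d → ℤ) j : ℤ) : ℝ) * t j)) ∂(PT d) := by
      intro i
      rw [integral_const_mul, integral_add (integrable_main s hs h1 _ _)
        (integrable_main s hs h1 _ _), ← ih, ← ih]
      ring
    simp_rw [this]
    rw [← integral_finsetSum]
    · refine integral_congr_ae (Filter.Eventually.of_forall fun t => ?_)
      simp only
      have key : ∀ i, s i * (phiT s t ^ n * ∏ j, cos ((((z - (x + Pi.single i 1) : Fin d → ℤ) j : ℤ) : ℝ) * t j)
            + phiT s t ^ n * ∏ j, cos ((((z - (x - Pi.single i 1) : Fin d → ℤ) j : ℤ) : ℝ) * t j))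
          = phiT s t ^ n * (∏ j, cos ((((z - x) j : ℤ) : ℝ) * t j)) * 2 * (s i * cos (t i)) := by
        intro i
        have e1 : z - (x + Pi.single i 1) = (z - x) + Pi.single i (-1) := by
          rw [Pi.single_neg]; abel
        have e2 : z - (x - Pi.single i 1) = (z - x) + Pi.single i 1 := by abel
        rw [e1, e2, prod_shift, prod_shift, ← Finset.mul_prod_erase _ _ (Finset.mem_univ i)]
        have a1 : (((z - x) i : ℤ) + ((-1 : ℤ) : ℝ)) * t i = ((z - x) i : ℤ) * t i - t i := by
          push_cast; ring
        have a2 : (((z - x) i : ℤ) + ((1 : ℤ) : ℝ)) * t i = ((z - x) i : ℤ) * t i + t i := by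
          push_cast; ring
        rw [a1, a2, cos_sub, cos_add]
        ring
      simp_rw [key]
      rw [← Finset.mul_sum, pow_succ]
      conv_rhs => rw [show phiT s t ^ n * phiT s t = phiT s t ^ n * (2 * ∑ j, s j * cos (t j)) from rfl]
      ring
    · intro i _
      exact ((integrable_main s hs h1 _ _).add (integrable_main s hs h1 _ _)).const_mul _

lemma abs_sin_int_mul_le (m : ℤ) (x : ℝ) : |sin ((m : ℝ) * x)| ≤ |(m : ℝ)| * |sin x| := by
  have nat : ∀ k : ℕ, |sin ((k : ℝ) * x)| ≤ (k : ℝ) * |sin x| := by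
    intro k
    induction k with
    | zero => simp
    | succ k ih =>
      push_cast
      rw [add_mul, one_mul, sin_add]
      refine (abs_add_le _ _).trans ?_
      rw [abs_mul, abs_mul]
      have := abs_cos_le_one x
      have := abs_cos_le_one (k * x)
      have := abs_nonneg (sin x)
      have := abs_nonneg (sin (k * x))
      nlinarith
  rcases Int.eq_nat_or_neg m with ⟨k, rfl | rfl⟩
  · simpa using nat k
  · simpa using nat k

lemma abs_cos_le_sub (x : ℝ) : |cos x| ≤ 1 - sin x ^ 2 / 2 := by
  have h := sin_sq_add_cos_sq x
  have := sq_abs (cos x)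
  nlinarith [sq_nonneg (|cos x| - 1)]

lemma abs_phiT_le_exp {d : ℕ} (s : Fin d → ℝ) (κ : ℝ) (hκ : 0 < κ) (hs : ∀ i, κ ≤ s i)
    (h1 : 2 * ∑ i, s i = 1) (t : Fin d → ℝ) :
    |phiT s t| ≤ ∏ j, exp (-κ * sin (t j) ^ 2) := by
  rw [← exp_sum]
  have : |phiT s t| ≤ 1 + ∑ j, (-κ * sin (t j) ^ 2) := by
    unfold phiT
    rw [abs_mul, abs_two, ← h1, Finset.mul_sum, ← Finset.sum_add_distrib]
    calc _ ≤ 2 * ∑ i, |s i * cos (t i)| := by gcongr; exact Finset.abs_sum_le_sum_abs _ _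
      _ = ∑ i, 2 * |s i * cos (t i)| := by rw [Finset.mul_sum]
      _ ≤ _ := by
        refine Finset.sum_le_sum fun i _ => ?_
        have hi : 0 ≤ s i := hκ.le.trans (hs i)
        rw [abs_mul, abs_of_nonneg hi]
        have := mul_le_mul_of_nonneg_left (abs_cos_le_sub (t i)) hi
        nlinarith [mul_le_mul_of_nonneg_right (hs i) (sq_nonneg (sin (t i)))]
  linarith [add_one_le_exp (∑ j, (-κ * sin (t j) ^ 2))]

lemma abs_phiT_le_mixed {d : ℕ} (s : Fin d → ℝ) (κ : ℝ) (hκ : 0 < κ) (hs : ∀ i, κ ≤ s i)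
    (h1 : 2 * ∑ i, s i = 1) (t : Fin d → ℝ) (i j : Fin d) (hi : 0 ≤ cos (t i))
    (hj : cos (t j) ≤ 0) (hij : i ≠ j) :
    |phiT s t| ≤ 1 - 2 * κ := by
  have hs0 : ∀ i, 0 ≤ s i := fun i => hκ.le.trans (hs i)
  have hup : ∑ k ∈ Finset.univ.erase j, s k * cos (t k) ≤ ∑ k ∈ Finset.univ.erase j, s k :=
    Finset.sum_le_sum fun k _ => mul_le_of_le_one_right (hs0 k) (cos_le_one _)
  have hlo : ∑ k ∈ Finset.univ.erase i, -(s k) ≤ ∑ k ∈ Finset.univ.erase i, s k * cos (t k) :=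
    Finset.sum_le_sum fun k _ => by nlinarith [neg_one_le_cos (t k), hs0 k]
  rw [Finset.sum_neg_distrib] at hlo
  have a1 := Finset.add_sum_erase Finset.univ s (Finset.mem_univ i)
  have a2 := Finset.add_sum_erase Finset.univ s (Finset.mem_univ j)
  have a3 := Finset.add_sum_erase Finset.univ (fun k => s k * cos (t k)) (Finset.mem_univ i)
  have a4 := Finset.add_sum_erase Finset.univ (fun k => s k * cos (t k)) (Finset.mem_univ j)
  beta_reduce at a3 a4
  unfold phiT
  rw [abs_le]
  have := mul_nonneg (hs0 i) hi
  have := mul_nonneg (hs0 j) (neg_nonneg.mpr hj)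
  have := hs i
  have := hs j
  constructor <;> nlinarith

lemma cos_diff_same (a b : ℝ) (h : (0 ≤ cos a ∧ 0 ≤ cos b) ∨ (cos a ≤ 0 ∧ cos b ≤ 0)) :
    |cos a - cos b| ≤ sin a ^ 2 + sin b ^ 2 := by
  have ha := sin_sq_add_cos_sq a
  have hb := sin_sq_add_cos_sq b
  have := cos_le_one a
  have := cos_le_one b
  have := neg_one_le_cos a
  have := neg_one_le_cos b
  rw [abs_le]
  rcases h with ⟨h1, h2⟩ | ⟨h1, h2⟩ <;> constructor <;> nlinarith

lemma x_exp_le (a y : ℝ) (ha : 0 < a) : y * exp (-a * y) ≤ (2 / a) * exp (-(a / 2) * y) := by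
  have h1 : exp (-a * y) = exp (-(a / 2) * y) * exp (-(a / 2) * y) := by
    rw [← exp_add]; ring_nf
  have h2 : y * exp (-(a / 2) * y) ≤ 2 / a := by
    have h3 := add_one_le_exp ((a / 2) * y)
    have h4 : exp ((a / 2) * y) * exp (-(a / 2) * y) = 1 := by rw [← exp_add]; simp
    have hp := exp_pos (-(a / 2) * y)
    have h5 : (a / 2 * y) * exp (-(a / 2) * y) ≤ 1 := by rw [← h4]; gcongr; linarith
    rw [le_div_iff₀ ha]
    linarith
  rw [h1, ← mul_assoc]
  gcongr

lemma sin_prod_le {d : ℕ} (a : ℝ) (ha : 0 < a) (t : Fin d → ℝ) (i : Fin d) :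
    sin (t i) ^ 2 * ∏ j, exp (-a * sin (t j) ^ 2)
      ≤ (2 / a) * ∏ j, exp (-(a / 2) * sin (t j) ^ 2) := by
  rw [← Finset.mul_prod_erase _ _ (Finset.mem_univ i), ← mul_assoc,
    ← Finset.mul_prod_erase Finset.univ (fun j => exp (-(a / 2) * sin (t j) ^ 2))
      (Finset.mem_univ i), ← mul_assoc]
  have h := x_exp_le a (sin (t i) ^ 2) ha
  refine mul_le_mul h ?_ (Finset.prod_nonneg fun _ _ => (exp_pos _).le) (by positivity)
  refine Finset.prod_le_prod (fun _ _ => (exp_pos _).le) fun j _ => ?_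
  gcongr
  nlinarith [sq_nonneg (sin (t j))]

lemma sin_sq_ge (x : ℝ) (h : |x| ≤ π / 2) : 4 / π ^ 2 * x ^ 2 ≤ sin x ^ 2 := by
  have h1 : 2 / π * |x| ≤ sin |x| := mul_le_sin (abs_nonneg _) h
  have h2 : sin |x| ^ 2 = sin x ^ 2 := by
    rcases abs_choice x with h | h <;> rw [h]
    rw [sin_neg]; ring
  rw [← h2, ← sq_abs x]
  calc _ = (2 / π * |x|) ^ 2 := by ring
    _ ≤ _ := by gcongr

lemma int_exp_sin (b : ℝ) (hb : 0 < b) :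
    ∫ x, exp (-b * sin x ^ 2) ∂muT ≤ 3 * √(π / (4 * b / π ^ 2)) := by
  set c := 4 * b / π ^ 2 with hc
  have hcp : 0 < c := by positivity
  have i0 : Integrable (fun x : ℝ => exp (-c * x ^ 2)) := integrable_exp_neg_mul_sq hcp
  have i1 := i0.comp_sub_right π
  have i2 := i0.comp_add_right π
  have hI := (i0.add i1).add i2
  have hpos : ∀ x : ℝ, 0 ≤ exp (-c * x ^ 2) + exp (-c * (x - π) ^ 2) + exp (-c * (x + π) ^ 2) :=
    fun x => by positivity
  calc ∫ x, exp (-b * sin x ^ 2) ∂muT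
      ≤ ∫ x in Set.Ioc (-π) π,
        (exp (-c * x ^ 2) + exp (-c * (x - π) ^ 2) + exp (-c * (x + π) ^ 2)) := by
        unfold muT
        refine setIntegral_mono_on ?_ hI.integrableOn measurableSet_Ioc fun x hx => ?_
        · exact (Continuous.integrableOn_Icc (by fun_prop)).mono_set Set.Ioc_subset_Icc_self
        · have gen : ∀ y, |y| ≤ π / 2 → sin y ^ 2 = sin x ^ 2 →
              exp (-b * sin x ^ 2) ≤ exp (-c * y ^ 2) := by
            intro y hy e
            have := sin_sq_ge y hy
            rw [← e]
            apply exp_le_exp.mpr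
            have : c * y ^ 2 = b * (4 / π ^ 2 * y ^ 2) := by rw [hc]; ring
            nlinarith
          have p0 := exp_pos (-c * x ^ 2)
          have p1 := exp_pos (-c * (x - π) ^ 2)
          have p2 := exp_pos (-c * (x + π) ^ 2)
          obtain ⟨hx1, hx2⟩ := hx
          rcases le_total x (-(π / 2)) with h | h
          · have := gen (x + π) (by rw [abs_le]; constructor <;> linarith)
              (by rw [sin_add_pi]; ring)
            linarith
          rcases le_total x (π / 2) with h' | h'
          · have := gen x (by rw [abs_le]; constructor <;> linarith) rfl
            linarith
          · have := gen (x - π) (by rw [abs_le]; constructor <;> linarith)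
              (by rw [sin_sub_pi]; ring)
            linarith
    _ ≤ ∫ x : ℝ, (exp (-c * x ^ 2) + exp (-c * (x - π) ^ 2) + exp (-c * (x + π) ^ 2)) :=
        setIntegral_le_integral hI (Filter.Eventually.of_forall hpos)
    _ = 3 * √(π / c) := by
        have e1 := integral_add (i0.add i1) i2
        simp only [Pi.add_apply] at e1
        rw [e1, integral_add i0 i1,
          integral_sub_right_eq_self (fun x : ℝ => exp (-c * x ^ 2)) π,
          integral_add_right_eq_self (fun x : ℝ => exp (-c * x ^ 2)) π, integral_gaussian]
        ring

lemma int_prod_exp {d : ℕ} (b : ℝ) (hb : 0 < b) :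
    ∫ t, ∏ j, exp (-b * sin (t j) ^ 2) ∂(PT d) ≤ (3 * √(π / (4 * b / π ^ 2))) ^ d := by
  unfold PT
  rw [integral_fintype_prod_eq_prod (𝕜 := ℝ) (f := fun _ y => exp (-b * sin y ^ 2))]
  rw [Finset.prod_const, Finset.card_univ, Fintype.card_fin]
  exact pow_le_pow_left₀ (integral_nonneg fun _ => (exp_pos _).le) (int_exp_sin b hb) d

/-- pointwise bound on the first part of the integrand -/
lemma part_one {d : ℕ} (s : Fin d → ℝ) (κ ρ : ℝ) (hκ : 0 < κ) (hs : ∀ i, κ ≤ s i)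
    (h1 : 2 * ∑ i, s i = 1) (hρ : 1 - 2 * κ ≤ ρ) (hρ0 : 0 ≤ ρ) (n : ℕ) (hn : 0 < n)
    (t : Fin d → ℝ) (i : Fin d) :
    |phiT s t| ^ n * |phiT s t - cos (t i)|
      ≤ 2 * ρ ^ n + 2 * (2 / (κ * n)) * ∏ j, exp (-(κ * n / 2) * sin (t j) ^ 2) := by
  have hs0 : ∀ i, 0 ≤ s i := fun i => hκ.le.trans (hs i)
  set R := 2 * ρ ^ n + 2 * (2 / (κ * n)) * ∏ j, exp (-(κ * n / 2) * sin (t j) ^ 2) with hR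
  have hn' : (0 : ℝ) < n := by exact_mod_cast hn
  have hE : 0 ≤ ∏ j, exp (-(κ * n / 2) * sin (t j) ^ 2) :=
    Finset.prod_nonneg fun _ _ => (exp_pos _).le
  have hpow : |phiT s t| ^ n ≤ ∏ j, exp (-(κ * n) * sin (t j) ^ 2) := by
    refine (pow_le_pow_left₀ (abs_nonneg _) (abs_phiT_le_exp s κ hκ hs h1 t) n).trans ?_
    rw [← Finset.prod_pow]
    refine le_of_eq (Finset.prod_congr rfl fun j _ => ?_)
    rw [← exp_nat_mul]; ring_nf
  have hpn : 0 ≤ |phiT s t| ^ n := by positivity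
  have each : ∀ j, |phiT s t| ^ n * |cos (t j) - cos (t i)| ≤ R := by
    intro j
    have same : ((0 ≤ cos (t j) ∧ 0 ≤ cos (t i)) ∨ (cos (t j) ≤ 0 ∧ cos (t i) ≤ 0)) →
        |phiT s t| ^ n * |cos (t j) - cos (t i)| ≤ R := by
      intro h
      have e1 := sin_prod_le (κ * n) (by positivity) t i
      have e2 := sin_prod_le (κ * n) (by positivity) t j
      calc _ ≤ (∏ j, exp (-(κ * n) * sin (t j) ^ 2)) * (sin (t j) ^ 2 + sin (t i) ^ 2) := by
            gcongr
            exact cos_diff_same _ _ h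
        _ ≤ R := by
            have : 0 ≤ ρ ^ n := by positivity
            rw [hR]; linarith
    have mixed : |phiT s t| ≤ 1 - 2 * κ → |phiT s t| ^ n * |cos (t j) - cos (t i)| ≤ R := by
      intro h
      have e1 : |phiT s t| ^ n ≤ ρ ^ n := pow_le_pow_left₀ (abs_nonneg _) (h.trans hρ) n
      have e2 : |cos (t j) - cos (t i)| ≤ 2 := by
        have := cos_le_one (t i)
        have := cos_le_one (t j)
        have := neg_one_le_cos (t i)
        have := neg_one_le_cos (t j)
        rw [abs_le]; constructor <;> linarith
      have e3 : 0 ≤ 2 * (2 / (κ * n)) * ∏ j, exp (-(κ * n / 2) * sin (t j) ^ 2) := by positivity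
      calc _ ≤ ρ ^ n * 2 := by gcongr
        _ ≤ R := by rw [hR]; linarith
    by_cases hij : i = j
    · subst hij
      simp only [sub_self, abs_zero, mul_zero]
      positivity
    rcases le_total 0 (cos (t i)) with a | a <;> rcases le_total 0 (cos (t j)) with b | b
    · exact same (Or.inl ⟨b, a⟩)
    · exact mixed (abs_phiT_le_mixed s κ hκ hs h1 t i j a b hij)
    · exact mixed (abs_phiT_le_mixed s κ hκ hs h1 t j i b a (Ne.symm hij))
    · exact same (Or.inr ⟨b, a⟩)
  have hdec : phiT s t - cos (t i) = ∑ j, 2 * s j * (cos (t j) - cos (t i)) := by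
    have : ∑ j, 2 * s j * (cos (t j) - cos (t i))
        = 2 * ∑ j, s j * cos (t j) - (2 * ∑ j, s j) * cos (t i) := by
      rw [Finset.mul_sum, Finset.mul_sum, Finset.sum_mul, ← Finset.sum_sub_distrib]
      exact Finset.sum_congr rfl fun j _ => by ring
    rw [this, h1, one_mul]; rfl
  rw [hdec]
  calc _ ≤ |phiT s t| ^ n * ∑ j, 2 * s j * |cos (t j) - cos (t i)| := by
        gcongr
        refine (Finset.abs_sum_le_sum_abs _ _).trans (Finset.sum_le_sum fun j _ => ?_)
        rw [abs_mul, abs_of_nonneg (by have := hs0 j; positivity)]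
    _ = ∑ j, 2 * s j * (|phiT s t| ^ n * |cos (t j) - cos (t i)|) := by
        rw [Finset.mul_sum]; exact Finset.sum_congr rfl fun j _ => by ring
    _ ≤ ∑ j, 2 * s j * R := Finset.sum_le_sum fun j _ =>
        mul_le_mul_of_nonneg_left (each j) (by have := hs0 j; positivity)
    _ = R := by rw [← Finset.sum_mul, ← Finset.mul_sum, h1, one_mul]

lemma part_two {d : ℕ} (s : Fin d → ℝ) (κ : ℝ) (hκ : 0 < κ) (hs : ∀ i, κ ≤ s i)
    (h1 : 2 * ∑ i, s i = 1) (n : ℕ) (hn : 0 < n) (t : Fin d → ℝ) (i : Fin d) :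
    |phiT s t| ^ n * sin (t i) ^ 2
      ≤ (2 / (κ * n)) * ∏ j, exp (-(κ * n / 2) * sin (t j) ^ 2) := by
  have hn' : (0 : ℝ) < n := by exact_mod_cast hn
  have hpow : |phiT s t| ^ n ≤ ∏ j, exp (-(κ * n) * sin (t j) ^ 2) := by
    refine (pow_le_pow_left₀ (abs_nonneg _) (abs_phiT_le_exp s κ hκ hs h1 t) n).trans ?_
    rw [← Finset.prod_pow]
    refine le_of_eq (Finset.prod_congr rfl fun j _ => ?_)
    rw [← exp_nat_mul]; ring_nf
  calc _ ≤ (∏ j, exp (-(κ * n) * sin (t j) ^ 2)) * sin (t i) ^ 2 := by gcongr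
    _ ≤ _ := by rw [mul_comm]; exact sin_prod_le (κ * n) (by positivity) t i

/-- pointwise bound on the integrand -/
lemma integrand_bound {d : ℕ} (s : Fin d → ℝ) (κ ρ : ℝ) (hκ : 0 < κ) (hs : ∀ i, κ ≤ s i)
    (h1 : 2 * ∑ i, s i = 1) (hρ : 1 - 2 * κ ≤ ρ) (hρ0 : 0 ≤ ρ) (n : ℕ) (hn : 0 < n)
    (t : Fin d → ℝ) (i : Fin d) (c : ℤ) (hc : c = 1 ∨ c = -1) (z : Fin d → ℤ) :
    |phiT s t ^ (n + 1) * ∏ j, cos ((z j : ℝ) * t j)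
        - phiT s t ^ n * ∏ j, cos ((((z + Pi.single i c : Fin d → ℤ) j : ℤ) : ℝ) * t j)|
      ≤ 2 * ρ ^ n + (2 + |(z i : ℝ)|) * (2 / (κ * n))
          * ∏ j, exp (-(κ * n / 2) * sin (t j) ^ 2) := by
  have p1 := part_one s κ ρ hκ hs h1 hρ hρ0 n hn t i
  have p2 := part_two s κ hκ hs h1 n hn t i
  rw [prod_shift, ← Finset.mul_prod_erase _ _ (Finset.mem_univ i)]
  set A := ∏ j ∈ Finset.univ.erase i, cos ((z j : ℝ) * t j) with hA
  have hA1 : |A| ≤ 1 := abs_prod_cos_le _ _ _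
  have hcos : cos (((z i : ℝ) + c) * t i)
      = cos (z i * t i) * cos (t i) - c * (sin (z i * t i) * sin (t i)) := by
    rcases hc with rfl | rfl
    · push_cast; rw [add_mul, one_mul, cos_add]; ring
    · push_cast; rw [show ((z i : ℝ) + -1) * t i = z i * t i - t i by ring, cos_sub]; ring
  have hc1 : |(c : ℝ)| = 1 := by rcases hc with rfl | rfl <;> simp
  have e : phiT s t ^ (n + 1) * (cos (z i * t i) * A)
      - phiT s t ^ n * (cos (((z i : ℝ) + c) * t i) * A)
      = phiT s t ^ n * (phiT s t - cos (t i)) * (cos (z i * t i) * A)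
        + phiT s t ^ n * (sin (z i * t i) * sin (t i)) * (c * A) := by
    rw [hcos]; ring
  rw [e]
  refine (abs_add_le _ _).trans ?_
  have b1 : |phiT s t ^ n * (phiT s t - cos (t i)) * (cos (z i * t i) * A)|
      ≤ |phiT s t| ^ n * |phiT s t - cos (t i)| := by
    rw [abs_mul, abs_mul, abs_pow]
    refine mul_le_of_le_one_right (by positivity) ?_
    rw [abs_mul]
    exact mul_le_one₀ (abs_cos_le_one _) (abs_nonneg _) hA1
  have b2 : |phiT s t ^ n * (sin (z i * t i) * sin (t i)) * (c * A)|
      ≤ |(z i : ℝ)| * (|phiT s t| ^ n * sin (t i) ^ 2) := by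
    rw [abs_mul, abs_mul, abs_pow, abs_mul (c : ℝ), hc1, one_mul]
    refine (mul_le_of_le_one_right (by positivity) hA1).trans ?_
    rw [abs_mul, ← sq_abs (sin (t i))]
    calc _ ≤ |phiT s t| ^ n * ((|(z i : ℝ)| * |sin (t i)|) * |sin (t i)|) := by
          gcongr; exact abs_sin_int_mul_le _ _
      _ = _ := by ring
  have b3 := mul_le_mul_of_nonneg_left p2 (abs_nonneg (z i : ℝ))
  linarith

end

/-- Pointwise local-CLT-type difference bound for the symmetric, uniformly elliptic,
stationary nearest-neighbor walk on ℤ^d: there are constants `C` and `ρ < 1`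
depending only on `κ₀, d` such that for all `n`, all `i` and signs, and all `z`
with `n+1` and `∑ⱼ zⱼ` of the same parity,
`|p_{n+1}(0,z) - p_n(±e_i,z)| ≤ C (1 + |z_i|) n^{-(d+2)/2} + C ρⁿ`. -/
theorem stmt8 (d : ℕ) (hd : 0 < d) (κ₀ : ℝ) (hκ : 0 < κ₀) :
    ∃ C : ℝ, 0 < C ∧ ∃ ρ : ℝ, 0 < ρ ∧ ρ < 1 ∧
      ∀ (s : Fin d → ℝ), (∀ i, κ₀ ≤ s i) → (2 * ∑ i, s i = 1) →
      ∀ q : ℕ → (Fin d → ℤ) → (Fin d → ℤ) → ℝ,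
        (∀ z z', q 0 z z' = if z = z' then 1 else 0) →
        (∀ n z z', q (n + 1) z z' =
          ∑ i, s i * (q n (z + Pi.single i 1) z' + q n (z - Pi.single i 1) z')) →
        ∀ (n : ℕ) (i : Fin d) (σ : Bool) (z : Fin d → ℤ),
          ((n : ℤ) + 1) % 2 = (∑ j, z j) % 2 →
          |q (n + 1) 0 z - q n (Pi.single i (if σ then 1 else -1)) z|
            ≤ C * (1 + |(z i : ℝ)|) * (n : ℝ) ^ (-((d : ℝ) + 2) / 2) + C * ρ ^ n := by
  set K : ℝ := 3 * √(π ^ 3 / (2 * κ₀)) with hK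
  refine ⟨2 + 4 / κ₀ * K ^ d, by positivity, max (1 / 2) (1 - 2 * κ₀), by positivity,
    max_lt (by norm_num) (by linarith), ?_⟩
  intro s hs h1 q h0 hq n i σ z _
  set ρ := max (1 / 2) (1 - 2 * κ₀) with hρ
  have hρ0 : 0 ≤ ρ := le_trans (by norm_num) (le_max_left _ _)
  have hs0 : ∀ i, 0 ≤ s i := fun i => hκ.le.trans (hs i)
  obtain ⟨c, hc, hcσ⟩ : ∃ c : ℤ, (c = 1 ∨ c = -1) ∧
      z - Pi.single i (if σ then 1 else -1) = z + Pi.single i c := by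
    refine ⟨-(if σ then 1 else -1), by cases σ <;> simp, ?_⟩
    rw [Pi.single_neg]; abel
  have r1 := fourier_rep s hs0 h1 q h0 hq (n + 1) 0 z
  have r2 := fourier_rep s hs0 h1 q h0 hq n (Pi.single i (if σ then 1 else -1)) z
  rw [hcσ] at r2
  rw [sub_zero] at r1
  set Δ := q (n + 1) 0 z - q n (Pi.single i (if σ then 1 else -1)) z with hΔ
  have rep : (2 * π) ^ d * Δ = ∫ t, (phiT s t ^ (n + 1) * ∏ j, cos ((z j : ℝ) * t j)
        - phiT s t ^ n * ∏ j, cos ((((z + Pi.single i c : Fin d → ℤ) j : ℤ) : ℝ) * t j)) ∂(PT d) := by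
    rw [integral_sub (integrable_main s hs0 h1 _ _) (integrable_main s hs0 h1 _ _), ← r1, ← r2]
    ring
  have hpi : (1 : ℝ) ≤ (2 * π) ^ d := one_le_pow₀ (by linarith [pi_gt_three])
  have hpi0 : (0 : ℝ) < (2 * π) ^ d := by positivity
  have habs : (2 * π) ^ d * |Δ| ≤ ∫ t, |phiT s t ^ (n + 1) * ∏ j, cos ((z j : ℝ) * t j)
        - phiT s t ^ n * ∏ j, cos ((((z + Pi.single i c : Fin d → ℤ) j : ℤ) : ℝ) * t j)| ∂(PT d) := by
    rw [← abs_of_pos hpi0, ← abs_mul, rep]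
    exact abs_integral_le_integral_abs
  have hint : Integrable (fun t => |phiT s t ^ (n + 1) * ∏ j, cos ((z j : ℝ) * t j)
        - phiT s t ^ n * ∏ j, cos ((((z + Pi.single i c : Fin d → ℤ) j : ℤ) : ℝ) * t j)|) (PT d) :=
    ((integrable_main s hs0 h1 _ _).sub (integrable_main s hs0 h1 _ _)).abs
  have hKd : 0 ≤ 4 / κ₀ * K ^ d := by positivity
  rcases Nat.eq_zero_or_pos n with hn | hn
  · subst hn
    have hne : -((d : ℝ) + 2) / 2 ≠ 0 := by
      have : (0 : ℝ) < (d : ℝ) + 2 := by positivity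
      intro h; linarith
    rw [Nat.cast_zero, zero_rpow hne, mul_zero, zero_add, pow_zero, mul_one]
    have : (2 * π) ^ d * |Δ| ≤ (2 * π) ^ d * 2 := by
      refine habs.trans ?_
      calc _ ≤ ∫ t, (2 : ℝ) ∂(PT d) := by
            refine integral_mono hint (integrable_const _) fun t => ?_
            simp only [zero_add, pow_one, pow_zero, one_mul]
            refine (abs_sub _ _).trans ?_
            rw [abs_mul]
            have e1 := mul_le_one₀ (abs_phiT_le_one s hs0 h1 t) (abs_nonneg _)
              (abs_prod_cos_le Finset.univ z t)
            have e2 := abs_prod_cos_le Finset.univ (z + Pi.single i c) t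
            linarith
        _ = _ := by rw [integral_const, PT_univ, smul_eq_mul]
    have := le_of_mul_le_mul_left this hpi0
    linarith
  · have hn' : (0 : ℝ) < n := by exact_mod_cast hn
    set G : ℝ := (2 + |(z i : ℝ)|) * (2 / (κ₀ * n)) with hG
    have hG0 : 0 ≤ G := by positivity
    have iE : Integrable (fun t : Fin d → ℝ => ∏ j, exp (-(κ₀ * n / 2) * sin (t j) ^ 2))
        (PT d) := by
      refine integrable_of_cont_bdd (by fun_prop) 1 fun t => ?_
      rw [Finset.abs_prod]
      refine Finset.prod_le_one (fun _ _ => abs_nonneg _) fun j _ => ?_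
      rw [abs_of_pos (exp_pos _), exp_le_one_iff]
      have : 0 ≤ κ₀ * n / 2 * sin (t j) ^ 2 := by positivity
      linarith
    have hE := int_prod_exp (d := d) (κ₀ * n / 2) (by positivity)
    have hsq : 3 * √(π / (4 * (κ₀ * n / 2) / π ^ 2)) = K / √n := by
      rw [hK, mul_div_assoc 3 _ (√(n : ℝ)), ← sqrt_div (by positivity)]
      congr 2
      field_simp
      ring
    rw [hsq] at hE
    have hX : 0 ≤ (K / √n) ^ d := by positivity
    have main : (2 * π) ^ d * |Δ| ≤ (2 * π) ^ d * (2 * ρ ^ n + G * (K / √n) ^ d) := by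
      refine habs.trans ?_
      calc _ ≤ ∫ t, (2 * ρ ^ n + G * ∏ j, exp (-(κ₀ * n / 2) * sin (t j) ^ 2)) ∂(PT d) :=
            integral_mono hint ((integrable_const _).add (iE.const_mul _)) fun t =>
              integrand_bound s κ₀ ρ hκ hs h1 (le_max_right _ _) hρ0 n hn t i c hc z
        _ = (2 * π) ^ d * (2 * ρ ^ n)
            + G * ∫ t, ∏ j, exp (-(κ₀ * n / 2) * sin (t j) ^ 2) ∂(PT d) := by
            rw [integral_add (integrable_const _) (iE.const_mul _), integral_const, PT_univ,
              smul_eq_mul, integral_const_mul]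
        _ ≤ (2 * π) ^ d * (2 * ρ ^ n) + G * (K / √n) ^ d := by gcongr
        _ ≤ _ := by
            rw [mul_add]
            have := le_mul_of_one_le_left (mul_nonneg hG0 hX) hpi
            linarith
    have main := le_of_mul_le_mul_left main hpi0
    have hrp : (n : ℝ) ^ (-((d : ℝ) + 2) / 2) = 1 / n * (1 / √n) ^ d := by
      rw [show -((d : ℝ) + 2) / 2 = -1 + (-(1 / 2)) * d by ring, rpow_add hn', rpow_neg_one,
        rpow_mul hn'.le, rpow_natCast, rpow_neg hn'.le, ← sqrt_eq_rpow]
      simp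
    set r := (n : ℝ) ^ (-((d : ℝ) + 2) / 2) with hr
    have hr0 : 0 ≤ r := by positivity
    have hGr : G * (K / √n) ^ d = (2 + |(z i : ℝ)|) * (2 / κ₀ * K ^ d) * r := by
      rw [hrp, hG, div_pow, div_pow, one_pow]
      field_simp
    rw [hGr] at main
    refine main.trans ?_
    have hρn : 0 ≤ ρ ^ n := by positivity
    have hz := abs_nonneg (z i : ℝ)
    have t1 : 2 * ρ ^ n ≤ (2 + 4 / κ₀ * K ^ d) * ρ ^ n := by gcongr; linarith
    have t2 : (2 + |(z i : ℝ)|) * (2 / κ₀ * K ^ d) * r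
        ≤ (2 + 4 / κ₀ * K ^ d) * (1 + |(z i : ℝ)|) * r := by
      apply mul_le_mul_of_nonneg_right _ hr0
      have hY : 0 ≤ 2 / κ₀ * K ^ d := by positivity
      have : 4 / κ₀ * K ^ d = 2 * (2 / κ₀ * K ^ d) := by ring
      rw [this]
      nlinarith [mul_nonneg hz hY]
    linarith
end

section
/- Fourier representation of the Green function difference: for the stationary walk on ℤ^d with probabilities p ∈ (0,1)^𝒱, Σ_e p(e)=1, drift d₀ ≠ 0 (hence k = 2Σⱼ√(p(e_j)p(-e_j)) < 1), for each i: G^p(e_i,0) - G^p(0,0) = (2π)^{-d}(√(p(-e_i)/p(e_i)) - 1)∫_{[0,2π]^d} cos(u_i)/(1 - 2Σⱼ√(p(e_j)p(-e_j))cos(u_j)) du + (2π)^{-d}∫_{[0,2π]^d} (cos(u_i)-1)/(1 - 2Σⱼ√(p(e_j)p(-e_j))cos(u_j)) du. -/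
open MeasureTheory Real

/-- The unit steps of ℤ^d, encoded by `Fin d × Bool`: `(i, true) ↔ e_i`,
`(i, false) ↔ -e_i`. -/
def step (d : ℕ) (u : Fin d × Bool) : Fin d → ℤ :=
  Pi.single u.1 (if u.2 then 1 else -1)

/-- the box `[0,2π]^d`. -/
def gBox (d : ℕ) : Set (Fin d → ℝ) := Set.Icc (0 : Fin d → ℝ) (fun _ => 2 * π)

/-- the symbol of the symmetrised walk. -/
noncomputable def gPhi (d : ℕ) (c : Fin d → ℝ) (u : Fin d → ℝ) : ℝ :=
  2 * ∑ j, c j * Real.cos (u j)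

theorem gPhi_cont (d : ℕ) (c : Fin d → ℝ) : Continuous (gPhi d c) := by
  unfold gPhi
  fun_prop

theorem g_one (m : ℤ) :
    ∫ x in Set.Icc (0 : ℝ) (2 * π), Complex.exp ((m : ℂ) * x * Complex.I)
      = if m = 0 then ((2 * π : ℝ) : ℂ) else 0 := by
  have hpi : (0 : ℝ) ≤ 2 * π := by positivity
  rw [integral_Icc_eq_integral_Ioc, ← intervalIntegral.integral_of_le hpi]
  split_ifs with h
  · subst h
    simp
  · have hc : (m : ℂ) * Complex.I ≠ 0 := by
      simp [h, Complex.I_ne_zero]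
    have h1 : ∀ x : ℝ, Complex.exp ((m : ℂ) * x * Complex.I)
        = Complex.exp (((m : ℂ) * Complex.I) * x) := by
      intro x; congr 1; ring
    simp_rw [h1]
    rw [integral_exp_mul_complex hc]
    have h2 : (m : ℂ) * Complex.I * ((2 * π : ℝ) : ℂ) = m * (2 * π * Complex.I) := by
      push_cast; ring
    rw [h2, Complex.exp_int_mul_two_pi_mul_I]
    simp

theorem gBox_restrict (d : ℕ) : (volume : Measure (Fin d → ℝ)).restrict (gBox d)
    = Measure.pi (fun _ : Fin d => (volume : Measure ℝ).restrict (Set.Icc 0 (2 * π))) := by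
  unfold gBox
  rw [← Set.pi_univ_Icc, volume_pi, Measure.restrict_pi_pi]
  rfl

instance gBox_fin (d : ℕ) : IsFiniteMeasure ((volume : Measure (Fin d → ℝ)).restrict (gBox d)) :=
  ⟨by
    rw [Measure.restrict_apply_univ]
    exact isCompact_Icc.measure_lt_top⟩

theorem g_int (d : ℕ) (f : (Fin d → ℝ) → ℝ) (hf : Continuous f) :
    Integrable f (volume.restrict (gBox d)) :=
  hf.continuousOn.integrableOn_compact isCompact_Icc

theorem g_base (d : ℕ) (z : Fin d → ℤ) :
    ∫ u in gBox d, Real.cos (∑ j, (z j : ℝ) * u j) = if z = 0 then (2 * π) ^ d else 0 := by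
  have key : ∫ u in gBox d, ∏ j, Complex.exp ((z j : ℂ) * (u j : ℂ) * Complex.I)
      = if z = 0 then (((2 * π) ^ d : ℝ) : ℂ) else 0 := by
    rw [gBox_restrict,
      integral_fintype_prod_eq_prod (fun j (x : ℝ) => Complex.exp ((z j : ℂ) * (x : ℂ) * Complex.I))]
    simp_rw [g_one]
    split_ifs with h
    · subst h
      simp
    · obtain ⟨j, hj⟩ := Function.ne_iff.mp h
      apply Finset.prod_eq_zero (Finset.mem_univ j)
      exact if_neg hj
  have h2 : ∀ u : Fin d → ℝ, Real.cos (∑ j, (z j : ℝ) * u j)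
      = RCLike.re (∏ j, Complex.exp ((z j : ℂ) * (u j : ℂ) * Complex.I)) := by
    intro u
    rw [← Complex.exp_sum, ← Finset.sum_mul]
    have : (∑ j, (z j : ℂ) * (u j : ℂ)) = ((∑ j, (z j : ℝ) * u j : ℝ) : ℂ) := by
      push_cast; rfl
    rw [this]
    exact (Complex.exp_ofReal_mul_I_re _).symm
  simp_rw [h2]
  rw [integral_re, key]
  · split_ifs
    · exact Complex.ofReal_re _
    · simp
  · refine ContinuousOn.integrableOn_compact isCompact_Icc (Continuous.continuousOn ?_)
    fun_prop

theorem g_weight (d : ℕ) (r : Fin d → ℝ) (hr : ∀ j, r j ≠ 0) (z : Fin d → ℤ) (j : Fin d) (m : ℤ) :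
    ∏ l, r l ^ ((z + Pi.single j m : Fin d → ℤ) l) = (∏ l, r l ^ (z l)) * r j ^ m := by
  simp_rw [Pi.add_apply, zpow_add₀ (hr _)]
  rw [Finset.prod_mul_distrib]
  congr 1
  rw [Finset.prod_eq_single j]
  · simp
  · intro b _ hb
    simp [Pi.single_eq_of_ne hb]
  · simp

theorem g_lin (d : ℕ) (z : Fin d → ℤ) (j : Fin d) (m : ℤ) (u : Fin d → ℝ) :
    ∑ l, (((z + Pi.single j m : Fin d → ℤ) l : ℤ) : ℝ) * u l = (∑ l, (z l : ℝ) * u l) + m * u j := by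
  simp_rw [Pi.add_apply, Int.cast_add, add_mul]
  rw [Finset.sum_add_distrib]
  congr 1
  rw [Finset.sum_eq_single j]
  · simp
  · intro b _ hb
    simp [Pi.single_eq_of_ne hb]
  · simp

theorem g_rec (d : ℕ) (c : Fin d → ℝ) (n : ℕ) (z : Fin d → ℤ) :
    ∫ u in gBox d, Real.cos (∑ l, (z l : ℝ) * u l) * gPhi d c u ^ (n + 1)
    = ∑ j, c j * ((∫ u in gBox d, Real.cos (∑ l, (((z + Pi.single j 1 : Fin d → ℤ) l : ℤ) : ℝ) * u l) * gPhi d c u ^ n)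
      + ∫ u in gBox d, Real.cos (∑ l, (((z + Pi.single j (-1) : Fin d → ℤ) l : ℤ) : ℝ) * u l) * gPhi d c u ^ n) := by
  have hc := gPhi_cont d c
  have hi : ∀ y : Fin d → ℤ, Integrable
      (fun u => Real.cos (∑ l, (y l : ℝ) * u l) * gPhi d c u ^ n) (volume.restrict (gBox d)) :=
    fun y => g_int d _ (by fun_prop)
  have h1 : ∀ j, c j * ((∫ u in gBox d, Real.cos (∑ l, (((z + Pi.single j 1 : Fin d → ℤ) l : ℤ) : ℝ) * u l) * gPhi d c u ^ n)
      + ∫ u in gBox d, Real.cos (∑ l, (((z + Pi.single j (-1) : Fin d → ℤ) l : ℤ) : ℝ) * u l) * gPhi d c u ^ n)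
      = ∫ u in gBox d, c j * (Real.cos (∑ l, (((z + Pi.single j 1 : Fin d → ℤ) l : ℤ) : ℝ) * u l) * gPhi d c u ^ n
      + Real.cos (∑ l, (((z + Pi.single j (-1) : Fin d → ℤ) l : ℤ) : ℝ) * u l) * gPhi d c u ^ n) := by
    intro j
    rw [integral_const_mul, integral_add (hi _) (hi _)]
  simp_rw [h1]
  rw [← integral_finsetSum]
  · congr 1
    ext u
    simp_rw [g_lin]
    rw [pow_succ, mul_comm (gPhi d c u ^ n), ← mul_assoc]
    generalize gPhi d c u ^ n = P
    rw [gPhi]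
    rw [Finset.mul_sum, Finset.mul_sum, Finset.sum_mul]
    refine Finset.sum_congr rfl fun j _ => ?_
    push_cast
    rw [one_mul, neg_one_mul, Real.cos_add, Real.cos_add, Real.cos_neg, Real.sin_neg]
    ring
  · intro j _
    exact ((hi _).add (hi _)).const_mul _

theorem g_q (d : ℕ) (p : Fin d × Bool → ℝ)
    (hp : ∀ u, p u ∈ Set.Ioo (0 : ℝ) 1)
    (q : ℕ → (Fin d → ℤ) → (Fin d → ℤ) → ℝ)
    (hq0 : ∀ z z', q 0 z z' = if z = z' then 1 else 0)
    (hqs : ∀ n z z', q (n + 1) z z' = ∑ u, p u * q n (z + step d u) z')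
    (n : ℕ) : ∀ z, q n z 0 = (1 / (2 * π) ^ d) *
      (∏ l, Real.sqrt (p (l, false) / p (l, true)) ^ (z l)) *
      ∫ u in gBox d, Real.cos (∑ l, (z l : ℝ) * u l) *
        gPhi d (fun j => Real.sqrt (p (j, true) * p (j, false))) u ^ n := by
  have hr : ∀ l, Real.sqrt (p (l, false) / p (l, true)) ≠ 0 := fun l =>
    (Real.sqrt_pos.mpr (div_pos (hp _).1 (hp _).1)).ne'
  have hA : ∀ j, p (j, true) * Real.sqrt (p (j, false) / p (j, true))
      = Real.sqrt (p (j, true) * p (j, false)) := by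
    intro j
    have h1 := (hp (j, true)).1
    have h2 := (hp (j, false)).1
    symm
    rw [Real.sqrt_eq_iff_mul_self_eq (by positivity) (by positivity), mul_mul_mul_comm,
      Real.mul_self_sqrt (by positivity)]
    field_simp
  have hB : ∀ j, p (j, false) * (Real.sqrt (p (j, false) / p (j, true)))⁻¹
      = Real.sqrt (p (j, true) * p (j, false)) := by
    intro j
    have h1 := (hp (j, true)).1
    have h2 := (hp (j, false)).1
    symm
    rw [Real.sqrt_eq_iff_mul_self_eq (by positivity) (by positivity), mul_mul_mul_comm,
      ← mul_inv, Real.mul_self_sqrt (by positivity)]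
    field_simp
  induction n with
  | zero =>
    intro z
    rw [hq0]
    simp only [pow_zero, mul_one]
    rw [g_base]
    split_ifs with h
    · subst h
      have : (2 * π) ^ d ≠ 0 := by positivity
      simp
    · simp
  | succ n ih =>
    intro z
    rw [hqs, Fintype.sum_prod_type, g_rec, Finset.mul_sum]
    refine Finset.sum_congr rfl fun j _ => ?_
    rw [Fintype.sum_bool, ih, ih]
    simp only [step, if_true, Bool.false_eq_true, if_false]
    rw [g_weight d _ hr, g_weight d _ hr, zpow_one, zpow_neg_one, mul_add (Real.sqrt _), mul_add]
    congr 1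
    · rw [← hA]; ring
    · rw [← hB]; ring

theorem g_phi_le (d : ℕ) (c : Fin d → ℝ) (hc : ∀ j, 0 ≤ c j) (u : Fin d → ℝ) :
    |gPhi d c u| ≤ 2 * ∑ j, c j := by
  unfold gPhi
  rw [abs_mul, abs_two]
  gcongr
  refine (Finset.abs_sum_le_sum_abs _ _).trans (Finset.sum_le_sum fun j _ => ?_)
  rw [abs_mul, abs_of_nonneg (hc j)]
  exact mul_le_of_le_one_right (hc j) (Real.abs_cos_le_one _)

theorem g_k (d : ℕ) (p : Fin d × Bool → ℝ)
    (hp : ∀ u, p u ∈ Set.Ioo (0 : ℝ) 1) (hsum : ∑ u, p u = 1)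
    (hd0 : ∃ i : Fin d, p (i, true) ≠ p (i, false)) :
    2 * ∑ j, Real.sqrt (p (j, true) * p (j, false)) < 1 := by
  rw [← hsum, Fintype.sum_prod_type, Finset.mul_sum]
  simp_rw [Fintype.sum_bool]
  have key : ∀ j, p (j, true) + p (j, false) - 2 * Real.sqrt (p (j, true) * p (j, false))
      = (Real.sqrt (p (j, true)) - Real.sqrt (p (j, false))) ^ 2 := by
    intro j
    rw [sub_sq, Real.sq_sqrt (hp _).1.le, Real.sq_sqrt (hp _).1.le, Real.sqrt_mul (hp _).1.le]
    ring
  apply Finset.sum_lt_sum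
  · intro j _
    have := key j
    nlinarith [sq_nonneg (Real.sqrt (p (j, true)) - Real.sqrt (p (j, false)))]
  · obtain ⟨j, hj⟩ := hd0
    refine ⟨j, Finset.mem_univ j, ?_⟩
    have h := key j
    have : 0 < (Real.sqrt (p (j, true)) - Real.sqrt (p (j, false))) ^ 2 := by
      apply sq_pos_of_ne_zero
      intro h0
      exact hj ((Real.sqrt_inj (hp _).1.le (hp _).1.le).mp (sub_eq_zero.mp h0))
    linarith

theorem g_sum (d : ℕ) (c : Fin d → ℝ) (hc : ∀ j, 0 ≤ c j) (hk : 2 * ∑ j, c j < 1)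
    (f : (Fin d → ℝ) → ℝ) (hf : Continuous f) (hf1 : ∀ u, |f u| ≤ 1) :
    HasSum (fun n => ∫ u in gBox d, f u * gPhi d c u ^ n)
      (∫ u in gBox d, f u / (1 - gPhi d c u)) := by
  have hφ := gPhi_cont d c
  have hk0 : 0 ≤ 2 * ∑ j, c j := mul_nonneg zero_le_two (Finset.sum_nonneg fun j _ => hc j)
  refine hasSum_integral_of_dominated_convergence (fun n _ => (2 * ∑ j, c j) ^ n) ?_ ?_ ?_ ?_ ?_
  · intro n
    exact (g_int d _ (by fun_prop)).aestronglyMeasurable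
  · intro n
    refine Filter.Eventually.of_forall fun u => ?_
    rw [Real.norm_eq_abs, abs_mul, abs_pow]
    calc |f u| * |gPhi d c u| ^ n ≤ 1 * (2 * ∑ j, c j) ^ n := by
          gcongr
          · exact hf1 u
          · exact g_phi_le d c hc u
      _ = _ := one_mul _
  · exact Filter.Eventually.of_forall fun u => summable_geometric_of_lt_one hk0 hk
  · exact integrable_const _
  · refine Filter.Eventually.of_forall fun u => ?_
    rw [div_eq_mul_inv]
    exact (hasSum_geometric_of_abs_lt_one ((g_phi_le d c hc u).trans_lt hk)).mul_left _

/-- Fourier representation of the Green function difference `G^p(e_i,0) - G^p(0,0)`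
for the stationary walk on ℤ^d with nonzero drift. -/
theorem stmt11 (d : ℕ) (hd : 0 < d) (p : Fin d × Bool → ℝ)
    (hp : ∀ u, p u ∈ Set.Ioo (0 : ℝ) 1) (hsum : ∑ u, p u = 1)
    (hd0 : ∃ i : Fin d, p (i, true) ≠ p (i, false))
    (q : ℕ → (Fin d → ℤ) → (Fin d → ℤ) → ℝ)
    (hq0 : ∀ z z', q 0 z z' = if z = z' then 1 else 0)
    (hqs : ∀ n z z', q (n + 1) z z' = ∑ u, p u * q n (z + step d u) z')
    (G : (Fin d → ℤ) → (Fin d → ℤ) → ℝ)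
    (hG : ∀ z z', G z z' = ∑' n : ℕ, q n z z')
    (i : Fin d) :
    G (Pi.single i 1) 0 - G 0 0
      = (1 / (2 * π) ^ d) * (Real.sqrt (p (i, false) / p (i, true)) - 1) *
          (∫ u in Set.Icc (0 : Fin d → ℝ) (fun _ => 2 * π),
            Real.cos (u i) /
              (1 - 2 * ∑ j : Fin d,
                Real.sqrt (p (j, true) * p (j, false)) * Real.cos (u j)))
        + (1 / (2 * π) ^ d) *
          (∫ u in Set.Icc (0 : Fin d → ℝ) (fun _ => 2 * π),
            (Real.cos (u i) - 1) /
              (1 - 2 * ∑ j : Fin d,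
                Real.sqrt (p (j, true) * p (j, false)) * Real.cos (u j))) := by
  set c : Fin d → ℝ := fun j => Real.sqrt (p (j, true) * p (j, false)) with hcdef
  have hc : ∀ j, 0 ≤ c j := fun j => Real.sqrt_nonneg _
  have hk : 2 * ∑ j, c j < 1 := g_k d p hp hsum hd0
  have hGz : ∀ z, G z 0 = (1 / (2 * π) ^ d) *
      (∏ l, Real.sqrt (p (l, false) / p (l, true)) ^ (z l)) *
      ∫ u in gBox d, Real.cos (∑ l, (z l : ℝ) * u l) / (1 - gPhi d c u) := by
    intro z
    rw [hG]
    simp_rw [g_q d p hp q hq0 hqs]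
    exact ((g_sum d c hc hk _ (by fun_prop) (fun u => Real.abs_cos_le_one _)).mul_left _).tsum_eq
  have hne : ∀ u, 1 - gPhi d c u ≠ 0 := fun u => by
    have := (abs_le.mp (g_phi_le d c hc u)).2
    exact (by linarith : (0 : ℝ) < 1 - gPhi d c u).ne'
  have hφ := gPhi_cont d c
  have e1 : ∀ u : Fin d → ℝ, ∑ l, ((Pi.single i 1 : Fin d → ℤ) l : ℝ) * u l = u i := by
    intro u
    have := g_lin d 0 i 1 u
    simpa using this
  have e2 : ∏ l, Real.sqrt (p (l, false) / p (l, true)) ^ ((Pi.single i 1 : Fin d → ℤ) l)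
      = Real.sqrt (p (i, false) / p (i, true)) := by
    have := g_weight d (fun l => Real.sqrt (p (l, false) / p (l, true)))
      (fun l => (Real.sqrt_pos.mpr (div_pos (hp _).1 (hp _).1)).ne') 0 i 1
    simpa using this
  have e3 : ∫ u in gBox d, (Real.cos (u i) - 1) / (1 - gPhi d c u)
      = (∫ u in gBox d, Real.cos (u i) / (1 - gPhi d c u))
        - ∫ u in gBox d, 1 / (1 - gPhi d c u) := by
    rw [← integral_sub]
    · simp_rw [sub_div]
    · exact g_int d _ (Continuous.div (by fun_prop) (by fun_prop) hne)
    · exact g_int d _ (Continuous.div (by fun_prop) (by fun_prop) hne)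
  change _ = (1 / (2 * π) ^ d) * (Real.sqrt (p (i, false) / p (i, true)) - 1) *
      (∫ u in gBox d, Real.cos (u i) / (1 - gPhi d c u))
      + (1 / (2 * π) ^ d) * (∫ u in gBox d, (Real.cos (u i) - 1) / (1 - gPhi d c u))
  rw [e3, hGz, hGz, e2]
  simp_rw [e1]
  simp only [Pi.zero_apply, zpow_zero, Finset.prod_const_one, Int.cast_zero, zero_mul,
    Finset.sum_const_zero, Real.cos_zero]
  ring
end

section
/- Kalikow's formula: Let μ be a probability measure on uniformly elliptic environments Ω_{κ₀} on ℤ^d, U ⊂ ℤ^d connected with either U bounded or killing rate δ < 1, and z₀ ∈ U. Define the auxiliary transition probabilities ŵ(z,e) = E_μ(G_{U,δ}^ω(z₀,z)ω(z,e))/E_μ(G_{U,δ}^ω(z₀,z)) for z ∈ U. Then for all z ∈ U ∪ ∂U: E_μ(G_{U,δ}^ω(z₀,z)) = G_{U,δ}^{ŵ}(z₀,z). -/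
open MeasureTheory

section Aux

variable {d : ℕ} (U : Set (Fin d → ℤ)) [DecidablePred (· ∈ U)]

lemma aux_shift (φ : (Fin d → ℤ) → Fin d × Bool → ℝ)
    (hφ : ∀ u, Summable fun x => if x ∈ U then φ x u else 0) :
    HasSum (fun z => ∑ u, if z - step d u ∈ U then φ (z - step d u) u else 0)
      (∑' x, if x ∈ U then ∑ u, φ x u else 0) ∧
    Summable (fun x => if x ∈ U then ∑ u, φ x u else 0) := by
  have e : (fun x => if x ∈ U then ∑ u, φ x u else 0)
      = fun x => ∑ u, if x ∈ U then φ x u else 0 := by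
    funext x; split_ifs <;> simp
  rw [e]
  refine ⟨?_, summable_sum fun u _ => hφ u⟩
  rw [Summable.tsum_finsetSum (fun u _ => hφ u)]
  refine hasSum_sum fun u _ => ?_
  exact (Equiv.hasSum_iff (f := fun x => if x ∈ U then φ x u else 0)
    (Equiv.subRight (step d u))).mpr (hφ u).hasSum

variable (δ : ℝ) (p : (Fin d → ℤ) → Fin d × Bool → ℝ)
  (V : (Fin d → ℤ) → ℝ) (M c : ℝ) (z₀ : Fin d → ℤ)

/-- uniqueness -/
lemma aux_unique (hδ0 : 0 < δ) (hc : 0 < c) (hV0 : ∀ x, 0 ≤ V x) (hVM : ∀ x, V x ≤ M)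
    (hp0 : ∀ x u, 0 ≤ p x u) (hp1 : ∀ x, ∑ u, p x u ≤ 1)
    (hL : ∀ x ∈ U, δ * ∑ u, p x u * V (x + step d u) ≤ V x - c)
    (h : (Fin d → ℤ) → ℝ) (hs : Summable fun x => if x ∈ U then |h x| else 0)
    (heq : ∀ z, h z = δ * ∑ u, if z - step d u ∈ U then
      p (z - step d u) u * h (z - step d u) else 0) : ∀ z, h z = 0 := by
  have hple : ∀ x u, p x u ≤ 1 := fun x u =>
    (Finset.single_le_sum (f := fun u => p x u) (fun u _ => hp0 x u) (Finset.mem_univ u)).trans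
      (hp1 x)
  set φ : (Fin d → ℤ) → Fin d × Bool → ℝ := fun x u => δ * (p x u * |h x| * V (x + step d u))
    with hφ
  have hφs : ∀ u, Summable fun x => if x ∈ U then φ x u else 0 := by
    intro u
    refine Summable.of_nonneg_of_le (fun x => ?_) (fun x => ?_) (hs.mul_left (δ * M))
    · split_ifs
      · have := hp0 x u; have := hV0 (x + step d u); positivity
      · exact le_rfl
    · split_ifs
      · have h1 : p x u * |h x| ≤ |h x| := mul_le_of_le_one_left (abs_nonneg _) (hple x u)
        have h2 : p x u * |h x| * V (x + step d u) ≤ |h x| * M :=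
          mul_le_mul h1 (hVM _) (hV0 _) (abs_nonneg _)
        calc φ x u ≤ δ * (|h x| * M) := mul_le_mul_of_nonneg_left h2 hδ0.le
          _ = _ := by ring
      · simp
  obtain ⟨H1, H2⟩ := aux_shift U φ hφs
  have hle : ∀ z, |h z| * V z ≤ ∑ u, if z - step d u ∈ U then φ (z - step d u) u else 0 := by
    intro z
    have : |h z| ≤ δ * ∑ u, if z - step d u ∈ U then
      p (z - step d u) u * |h (z - step d u)| else 0 := by
      rw [heq z, abs_mul, abs_of_pos hδ0]
      refine mul_le_mul_of_nonneg_left ?_ hδ0.le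
      refine (Finset.abs_sum_le_sum_abs _ _).trans (Finset.sum_le_sum fun u _ => ?_)
      split_ifs
      · rw [abs_mul, abs_of_nonneg (hp0 _ _)]
      · simp
    refine (mul_le_mul_of_nonneg_right this (hV0 z)).trans (le_of_eq ?_)
    rw [Finset.mul_sum, Finset.sum_mul]
    refine Finset.sum_congr rfl fun u _ => ?_
    split_ifs
    · simp only [hφ, sub_add_cancel]; ring
    · simp
  have hVs : Summable fun z => |h z| * V z :=
    Summable.of_nonneg_of_le (fun z => mul_nonneg (abs_nonneg _) (hV0 z)) hle H1.summable
  have I1 := (hVs.tsum_le_tsum hle H1.summable).trans_eq H1.tsum_eq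
  have I2 : ∑' x, (if x ∈ U then ∑ u, φ x u else 0)
      ≤ ∑' x, (|h x| * V x - c * (if x ∈ U then |h x| else 0)) := by
    refine H2.tsum_le_tsum (fun x => ?_) (hVs.sub (hs.mul_left c))
    split_ifs with hx
    · have e : ∑ u, φ x u = |h x| * (δ * ∑ u, p x u * V (x + step d u)) := by
        simp only [hφ, Finset.mul_sum]
        exact Finset.sum_congr rfl fun u _ => by ring
      rw [e]
      calc _ ≤ |h x| * (V x - c) := mul_le_mul_of_nonneg_left (hL x hx) (abs_nonneg _)
        _ = _ := by ring
    · have := mul_nonneg (abs_nonneg (h x)) (hV0 x); simpa using this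
  rw [hVs.tsum_sub (hs.mul_left c), tsum_mul_left] at I2
  have I3 : ∑' x, (if x ∈ U then |h x| else 0) ≤ 0 := by
    by_contra hh
    push Not at hh
    have := mul_pos hc hh
    linarith
  have hU : ∀ x ∈ U, h x = 0 := by
    intro x hx
    have := (hs.le_tsum x (fun y _ => by split_ifs <;> positivity)).trans I3
    simpa [hx] using this
  intro z
  rw [heq z]
  refine mul_eq_zero_of_right _ (Finset.sum_eq_zero fun u _ => ?_)
  split_ifs with hx
  · simp [hU _ hx]
  · rfl

/-- properties of the Green function -/
lemma aux_green (hδ0 : 0 < δ) (hc : 0 < c) (hV0 : ∀ x, 0 ≤ V x) (hVM : ∀ x, V x ≤ M)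
    (hp0 : ∀ x u, 0 ≤ p x u) (hp1 : ∀ x, ∑ u, p x u ≤ 1)
    (hL : ∀ x ∈ U, δ * ∑ u, p x u * V (x + step d u) ≤ V x - c)
    (q : ℕ → (Fin d → ℤ) → ℝ)
    (hq0 : ∀ z, q 0 z = if z = z₀ then 1 else 0)
    (hqs : ∀ n z, q (n + 1) z =
      ∑ u, if z - step d u ∈ U then p (z - step d u) u * q n (z - step d u) else 0)
    (G : (Fin d → ℤ) → ℝ) (hG : ∀ z, G z = ∑' n : ℕ, δ ^ n * q n z) :
    (∀ z, 0 ≤ G z) ∧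
    (∀ F : Finset (Fin d → ℤ), ∑ z ∈ F, (if z ∈ U then G z else 0) ≤ M / c) ∧
    (∀ z, G z = (if z = z₀ then 1 else 0) + δ * ∑ u, if z - step d u ∈ U then
      p (z - step d u) u * G (z - step d u) else 0) := by
  have hple : ∀ x u, p x u ≤ 1 := fun x u =>
    (Finset.single_le_sum (f := fun u => p x u) (fun u _ => hp0 x u) (Finset.mem_univ u)).trans
      (hp1 x)
  have hqn : ∀ n z, 0 ≤ q n z := by
    intro n
    induction n with
    | zero => intro z; rw [hq0]; split_ifs <;> norm_num
    | succ n ih =>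
      intro z; rw [hqs]
      refine Finset.sum_nonneg fun u _ => ?_
      split_ifs
      · exact mul_nonneg (hp0 _ _) (ih _)
      · exact le_rfl
  have hqS : ∀ n, Summable (q n) := by
    intro n
    induction n with
    | zero =>
      have : q 0 = fun z => if z = z₀ then 1 else 0 := funext hq0
      rw [this]
      exact (hasSum_ite_eq z₀ (1 : ℝ)).summable
    | succ n ih =>
      have : q (n + 1) = fun z => ∑ u, if z - step d u ∈ U then
        p (z - step d u) u * q n (z - step d u) else 0 := funext (hqs n)
      rw [this]
      refine (aux_shift U (fun x u => p x u * q n x) fun u => ?_).1.summable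
      refine Summable.of_nonneg_of_le (fun x => ?_) (fun x => ?_) ih
      · split_ifs
        · exact mul_nonneg (hp0 _ _) (hqn _ _)
        · exact le_rfl
      · split_ifs
        · exact mul_le_of_le_one_left (hqn _ _) (hple x u)
        · exact hqn _ _
  have hVS : ∀ n, Summable fun z => δ ^ n * q n z * V z := by
    intro n
    refine Summable.of_nonneg_of_le (fun x => ?_) (fun x => ?_) ((hqS n).mul_left (δ ^ n * M))
    · have := hqn n x; have := hV0 x; positivity
    · have h1 : 0 ≤ δ ^ n * q n x := by have := hqn n x; positivity
      calc _ ≤ δ ^ n * q n x * M := mul_le_mul_of_nonneg_left (hVM x) h1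
        _ = _ := by ring
  have hbS : ∀ n, Summable fun z => if z ∈ U then δ ^ n * q n z else 0 := by
    intro n
    refine Summable.of_nonneg_of_le (fun x => ?_) (fun x => ?_) ((hqS n).mul_left (δ ^ n))
    · have := hqn n x; split_ifs <;> positivity
    · have := hqn n x
      split_ifs
      · exact le_rfl
      · positivity
  have hstep : ∀ n, (∑' z, δ ^ (n + 1) * q (n + 1) z * V z)
      + c * (∑' z, if z ∈ U then δ ^ n * q n z else 0) ≤ ∑' z, δ ^ n * q n z * V z := by
    intro n
    set φ : (Fin d → ℤ) → Fin d × Bool → ℝ :=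
      fun x u => δ ^ (n + 1) * (p x u * q n x * V (x + step d u)) with hφ
    have hφs : ∀ u, Summable fun x => if x ∈ U then φ x u else 0 := by
      intro u
      refine Summable.of_nonneg_of_le (fun x => ?_) (fun x => ?_)
        ((hqS n).mul_left (δ ^ (n + 1) * M))
      · split_ifs
        · have := hp0 x u; have := hV0 (x + step d u); have := hqn n x; positivity
        · exact le_rfl
      · have h0 := hqn n x
        split_ifs
        · have h1 : p x u * q n x ≤ q n x := mul_le_of_le_one_left h0 (hple x u)
          have h2 : p x u * q n x * V (x + step d u) ≤ q n x * M :=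
            mul_le_mul h1 (hVM _) (hV0 _) h0
          calc φ x u ≤ δ ^ (n + 1) * (q n x * M) :=
                mul_le_mul_of_nonneg_left h2 (by positivity)
            _ = _ := by ring
        · have : 0 ≤ M := (hV0 x).trans (hVM x)
          positivity
    obtain ⟨H1, H2⟩ := aux_shift U φ hφs
    have e1 : (∑' z, δ ^ (n + 1) * q (n + 1) z * V z)
        = ∑' x, if x ∈ U then ∑ u, φ x u else 0 := by
      rw [← H1.tsum_eq]
      refine tsum_congr fun z => ?_
      rw [hqs, Finset.mul_sum, Finset.sum_mul]
      refine Finset.sum_congr rfl fun u _ => ?_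
      split_ifs
      · simp only [hφ, sub_add_cancel]; ring
      · simp
    rw [e1, ← tsum_mul_left, ← H2.tsum_add ((hbS n).mul_left c)]
    refine (H2.add ((hbS n).mul_left c)).tsum_le_tsum (fun x => ?_) (hVS n)
    have h0 := hqn n x
    split_ifs with hx
    · have e : ∑ u, φ x u = δ ^ n * q n x * (δ * ∑ u, p x u * V (x + step d u)) := by
        simp only [hφ, Finset.mul_sum]
        exact Finset.sum_congr rfl fun u _ => by ring
      rw [e]
      have := mul_le_mul_of_nonneg_left (hL x hx) (show 0 ≤ δ ^ n * q n x by positivity)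
      linarith
    · have := hV0 x
      simp only [mul_zero, add_zero]
      positivity
  have hsum : ∀ N, (∑' z, δ ^ N * q N z * V z)
      + c * ∑ n ∈ Finset.range N, (∑' z, if z ∈ U then δ ^ n * q n z else 0) ≤ M := by
    intro N
    induction N with
    | zero =>
      simp only [Finset.range_zero, Finset.sum_empty, mul_zero, add_zero, pow_zero, one_mul, hq0,
        ite_mul, zero_mul, tsum_ite_eq]
      exact hVM z₀
    | succ N ih =>
      rw [Finset.sum_range_succ, mul_add]
      have := hstep N
      linarith
  have hb : ∀ N, ∑ n ∈ Finset.range N, (∑' z, if z ∈ U then δ ^ n * q n z else 0) ≤ M / c := by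
    intro N
    rw [le_div_iff₀ hc]
    have : 0 ≤ ∑' z, δ ^ N * q N z * V z := tsum_nonneg fun z => by
      have := hqn N z; have := hV0 z; positivity
    have := hsum N
    linarith
  have hFb : ∀ (F : Finset (Fin d → ℤ)) N,
      ∑ n ∈ Finset.range N, (∑ z ∈ F, if z ∈ U then δ ^ n * q n z else 0) ≤ M / c := by
    intro F N
    refine (Finset.sum_le_sum fun n _ => ?_).trans (hb N)
    exact (hbS n).sum_le_tsum F fun z _ => by have := hqn n z; split_ifs <;> positivity
  have hSU : ∀ z ∈ U, Summable fun n => δ ^ n * q n z := by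
    intro z hz
    refine summable_of_sum_range_le (c := M / c) (fun n => ?_) (fun N => ?_)
    · have := hqn n z; positivity
    · simpa [hz] using hFb {z} N
  have hrec : ∀ z, HasSum (fun n => δ ^ n * q n z) ((if z = z₀ then 1 else 0) +
      δ * ∑ u, if z - step d u ∈ U then
      p (z - step d u) u * G (z - step d u) else 0) := by
    intro z
    rw [add_comm]
    have key : HasSum (fun n => δ ^ (n + 1) * q (n + 1) z) (δ * ∑ u, if z - step d u ∈ U then
      p (z - step d u) u * G (z - step d u) else 0) := by
      have : (fun n => δ ^ (n + 1) * q (n + 1) z) = fun n => δ * ∑ u, if z - step d u ∈ U then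
          p (z - step d u) u * (δ ^ n * q n (z - step d u)) else 0 := by
        funext n
        rw [hqs, Finset.mul_sum, Finset.mul_sum]
        refine Finset.sum_congr rfl fun u _ => ?_
        split_ifs
        · ring
        · simp
      rw [this]
      refine HasSum.mul_left _ (hasSum_sum fun u _ => ?_)
      split_ifs with hx
      · rw [hG]
        exact (hSU _ hx).hasSum.mul_left _
      · exact hasSum_zero
    have := (hasSum_nat_add_iff (f := fun n => δ ^ n * q n z) 1).mp key
    simpa [hq0] using this
  refine ⟨fun z => ?_, fun F => ?_, fun z => ?_⟩
  · rw [hG]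
    exact tsum_nonneg fun n => by have := hqn n z; positivity
  · have hs : ∀ z ∈ F, HasSum (fun n => if z ∈ U then δ ^ n * q n z else 0)
        (if z ∈ U then G z else 0) := by
      intro z _
      split_ifs with hz
      · rw [hG]; exact (hSU z hz).hasSum
      · exact hasSum_zero
    have := hasSum_sum hs
    rw [← this.tsum_eq]
    exact Real.tsum_le_of_sum_range_le (fun n => Finset.sum_nonneg fun z _ => by
      have := hqn n z; split_ifs <;> positivity) (hFb F)
  · rw [hG z]; exact (hrec z).tsum_eq

/-- existence of a Lyapunov function -/
lemma aux_lyap (hd : 0 < d) (κ₀ : ℝ) (hκ : 0 < κ₀) (hδ0 : 0 < δ) (hδ1 : δ ≤ 1)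
    (hUδ : U.Finite ∨ δ < 1) (hz₀ : z₀ ∈ U) :
    ∃ (V : (Fin d → ℤ) → ℝ) (M c : ℝ), 0 < c ∧ (∀ x, 0 ≤ V x) ∧ (∀ x, V x ≤ M) ∧
      ∀ w : (Fin d → ℤ) → Fin d × Bool → ℝ, (∀ x u, κ₀ ≤ w x u) → (∀ x, ∑ u, w x u = 1) →
        ∀ x ∈ U, δ * ∑ u, w x u * V (x + step d u) ≤ V x - c := by
  rcases hUδ with hU | hδ
  · set R : ℝ := 2 / κ₀ with hR
    have hR0 : 0 < R := by positivity
    set f : (Fin d → ℤ) → ℝ := fun x => R ^ (x ⟨0, hd⟩) with hf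
    have hf0 : ∀ x, 0 < f x := fun x => zpow_pos hR0 _
    obtain ⟨x₁, hx₁, hmin⟩ := Set.exists_min_image U f hU ⟨z₀, hz₀⟩
    obtain ⟨x₂, hx₂, hmax⟩ :=
      Set.exists_max_image U (fun x => f x + ∑ u, f (x + step d u)) hU ⟨z₀, hz₀⟩
    set M := f x₂ + ∑ u, f (x₂ + step d u) with hM
    have hS0 : ∀ x, 0 ≤ ∑ u, f (x + step d u) := fun x => Finset.sum_nonneg fun u _ => (hf0 _).le
    have hM0 : 0 ≤ M := add_nonneg (hf0 _).le (hS0 _)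
    refine ⟨fun x => max 0 (M - f x), M, f x₁, hf0 _, fun x => le_max_left _ _,
      fun x => max_le hM0 (by linarith [hf0 x]), ?_⟩
    intro w hw hw1 x hx
    have hnb : ∀ u, f (x + step d u) ≤ M := fun u => by
      have h1 := hmax x hx
      have h2 := Finset.single_le_sum (f := fun u => f (x + step d u)) (fun u _ => (hf0 _).le)
        (Finset.mem_univ u)
      have h3 := hf0 x
      linarith
    have hxM : f x ≤ M := by
      have h1 := hmax x hx
      have := hS0 x
      linarith
    have hw0 : ∀ u, 0 ≤ w x u := fun u => hκ.le.trans (hw x u)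
    have e : ∑ u, w x u * max 0 (M - f (x + step d u)) = M - ∑ u, w x u * f (x + step d u) := by
      have : ∀ u, w x u * max 0 (M - f (x + step d u)) = w x u * M - w x u * f (x + step d u) := by
        intro u
        rw [max_eq_right (by linarith [hnb u])]; ring
      simp only [this, Finset.sum_sub_distrib, ← Finset.sum_mul, hw1, one_mul]
    have h2f : 2 * f x ≤ ∑ u, w x u * f (x + step d u) := by
      have h2 := Finset.single_le_sum (f := fun u => w x u * f (x + step d u))
        (fun u _ => mul_nonneg (hw0 u) (hf0 _).le) (Finset.mem_univ (⟨0, hd⟩, true))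
      have h3 : f (x + step d (⟨0, hd⟩, true)) = f x * R := by
        simp only [hf, step, Pi.add_apply, Pi.single_eq_same, if_true]
        rw [zpow_add_one₀ hR0.ne']
      have h4 : κ₀ * (f x * R) = 2 * f x := by rw [hR]; field_simp
      rw [← h4]
      refine le_trans ?_ h2
      simp only [h3]
      exact mul_le_mul_of_nonneg_right (hw _ _) (mul_pos (hf0 x) hR0).le
    have hnn : 0 ≤ ∑ u, w x u * max 0 (M - f (x + step d u)) :=
      Finset.sum_nonneg fun u _ => mul_nonneg (hw0 u) (le_max_left _ _)
    refine (mul_le_of_le_one_left hnn hδ1).trans ?_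
    have e3 : max 0 (M - f x) = M - f x := max_eq_right (by linarith)
    rw [e]
    simp only [e3]
    linarith [hmin x hx]
  · refine ⟨fun _ => 1, 1, 1 - δ, by linarith, fun _ => zero_le_one, fun _ => le_rfl, ?_⟩
    intro w _ hw1 x _
    simp [hw1]

end Aux

/-- Kalikow's formula: for a probability measure `μ` on uniformly elliptic
environments, a connected `U ⊆ ℤ^d` (with `U` bounded or `δ < 1`) and `z₀ ∈ U`,
the annealed Green function equals the Green function of the auxiliary walk with
transition probabilities `ŵ(z,u) = E_μ(G_{U,δ}^ω(z₀,z) ω(z,u)) / E_μ(G_{U,δ}^ω(z₀,z))`: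
for every `z ∈ U ∪ ∂U`, `E_μ(G_{U,δ}^ω(z₀,z)) = G_{U,δ}^{ŵ}(z₀,z)`. -/
theorem stmt14 (d : ℕ) (hd : 0 < d) (κ₀ : ℝ) (hκ : 0 < κ₀)
    {E : Type*} [MeasurableSpace E] (μ : Measure E) [IsProbabilityMeasure μ]
    (ω : E → (Fin d → ℤ) → Fin d × Bool → ℝ)
    (hω : ∀ η x u, κ₀ ≤ ω η x u) (hω1 : ∀ η x, ∑ u, ω η x u = 1)
    (hωmeas : ∀ x u, Measurable fun η => ω η x u)
    (U : Set (Fin d → ℤ)) [DecidablePred (· ∈ U)]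
    (hconn : ∀ x ∈ U, ∀ y ∈ U, ∃ (n : ℕ) (γ : ℕ → Fin d → ℤ),
      γ 0 = x ∧ γ n = y ∧ ∀ k < n, γ (k + 1) ∈ U ∧ ∃ u, γ (k + 1) = γ k + step d u)
    (δ : ℝ) (hδ0 : 0 < δ) (hδ1 : δ ≤ 1) (hUδ : U.Finite ∨ δ < 1)
    (z₀ : Fin d → ℤ) (hz₀ : z₀ ∈ U)
    (q : E → ℕ → (Fin d → ℤ) → ℝ)
    (hq0 : ∀ η z, q η 0 z = if z = z₀ then 1 else 0)
    (hqs : ∀ η n z, q η (n + 1) z =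
      ∑ u, if z - step d u ∈ U then ω η (z - step d u) u * q η n (z - step d u) else 0)
    (G : E → (Fin d → ℤ) → ℝ) (hG : ∀ η z, G η z = ∑' n : ℕ, δ ^ n * q η n z)
    (hGmeas : ∀ z, Measurable fun η => G η z)
    (hGint : ∀ z, Integrable (fun η => G η z) μ)
    (hGωint : ∀ z u, Integrable (fun η => G η z * ω η z u) μ)
    (what : (Fin d → ℤ) → Fin d × Bool → ℝ)
    (hwhat : ∀ z u, what z u = (∫ η, G η z * ω η z u ∂μ) / ∫ η, G η z ∂μ)
    (qhat : ℕ → (Fin d → ℤ) → ℝ)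
    (hqhat0 : ∀ z, qhat 0 z = if z = z₀ then 1 else 0)
    (hqhats : ∀ n z, qhat (n + 1) z =
      ∑ u, if z - step d u ∈ U then what (z - step d u) u * qhat n (z - step d u) else 0)
    (Ghat : (Fin d → ℤ) → ℝ) (hGhat : ∀ z, Ghat z = ∑' n : ℕ, δ ^ n * qhat n z) :
    ∀ z, z ∈ U ∪ {x : Fin d → ℤ | x ∉ U ∧ ∃ u, x + step d u ∈ U} →
      ∫ η, G η z ∂μ = Ghat z := by
  intro z _
  obtain ⟨V, M, c, hc, hV0, hVM, hL⟩ := aux_lyap U δ z₀ hd κ₀ hκ hδ0 hδ1 hUδ hz₀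
  have hω0 : ∀ η x u, 0 ≤ ω η x u := fun η x u => hκ.le.trans (hω η x u)
  have hLω : ∀ η, ∀ x ∈ U, δ * ∑ u, ω η x u * V (x + step d u) ≤ V x - c :=
    fun η => hL (ω η) (hω η) (hω1 η)
  have hgr := fun η => aux_green U δ (ω η) V M c z₀ hδ0 hc hV0 hVM (hω0 η)
    (fun x => (hω1 η x).le) (hLω η) (q η) (hq0 η) (hqs η) (G η) (hG η)
  have hG0 : ∀ η z, 0 ≤ G η z := fun η => (hgr η).1
  set g : (Fin d → ℤ) → ℝ := fun z => ∫ η, G η z ∂μ with hg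
  have hg0 : ∀ z, 0 ≤ g z := fun z => integral_nonneg fun η => hG0 η z
  have hI0 : ∀ z u, 0 ≤ ∫ η, G η z * ω η z u ∂μ :=
    fun z u => integral_nonneg fun η => mul_nonneg (hG0 η z) (hω0 η z u)
  have hw0 : ∀ z u, 0 ≤ what z u := fun z u => by
    rw [hwhat]; exact div_nonneg (hI0 z u) (hg0 z)
  have hIsum : ∀ z, ∑ u, ∫ η, G η z * ω η z u ∂μ = g z := by
    intro z
    rw [← integral_finsetSum _ fun u _ => hGωint z u]
    simp only [← Finset.mul_sum, hω1, mul_one, hg]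
  have hIle : ∀ z u, ∫ η, G η z * ω η z u ∂μ ≤ g z := fun z u => by
    rw [← hIsum z]
    exact Finset.single_le_sum (f := fun u => ∫ η, G η z * ω η z u ∂μ) (fun u _ => hI0 z u)
      (Finset.mem_univ u)
  have hwg : ∀ z u, what z u * g z = ∫ η, G η z * ω η z u ∂μ := by
    intro z u
    rw [hwhat]
    by_cases h : g z = 0
    · have h1 := hIle z u
      have h2 := hI0 z u
      rw [h] at h1 ⊢
      rw [mul_zero]; linarith
    · exact div_mul_cancel₀ _ h
  have hwz : ∀ z u, g z = 0 → what z u = 0 := by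
    intro z u h
    rw [hwhat]
    change _ / g z = 0
    rw [h, div_zero]
  have hw1 : ∀ z, ∑ u, what z u ≤ 1 := by
    intro z
    by_cases h : g z = 0
    · simp [hwz z _ h]
    · have : (∑ u, what z u) * g z = 1 * g z := by
        rw [Finset.sum_mul]; simp only [hwg, hIsum, one_mul]
      exact (mul_right_cancel₀ h this).le
  have hLw : ∀ x ∈ U, δ * ∑ u, what x u * V (x + step d u) ≤ V x - c := by
    intro x hx
    by_cases h : g x = 0
    · obtain ⟨η⟩ : Nonempty E := nonempty_of_isProbabilityMeasure μ
      have h1 := hLω η x hx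
      have h2 : 0 ≤ δ * ∑ u, ω η x u * V (x + step d u) :=
        mul_nonneg hδ0.le (Finset.sum_nonneg fun u _ => mul_nonneg (hω0 η x u) (hV0 _))
      simp only [hwz x _ h, zero_mul, Finset.sum_const_zero, mul_zero]
      linarith
    · have hgpos : 0 < g x := lt_of_le_of_ne (hg0 x) (Ne.symm h)
      refine le_of_mul_le_mul_right ?_ hgpos
      have e : (δ * ∑ u, what x u * V (x + step d u)) * g x
          = ∫ η, ∑ u, (G η x * ω η x u) * (δ * V (x + step d u)) ∂μ := by
        rw [integral_finsetSum _ fun u _ => (hGωint x u).mul_const _]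
        simp only [integral_mul_const, ← hwg]
        rw [Finset.mul_sum, Finset.sum_mul]
        exact Finset.sum_congr rfl fun u _ => by ring
      have e2 : (V x - c) * g x = ∫ η, (V x - c) * G η x ∂μ := by
        rw [integral_const_mul]
      rw [e, e2]
      refine integral_mono (integrable_finsetSum _ fun u _ => (hGωint x u).mul_const _)
        ((hGint x).const_mul _) fun η => ?_
      have h1 := mul_le_mul_of_nonneg_left (hLω η x hx) (hG0 η x)
      refine le_trans (le_of_eq ?_) (h1.trans_eq (mul_comm _ _))
      simp only [Finset.mul_sum]
      exact Finset.sum_congr rfl fun u _ => by ring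
  obtain ⟨hH0, hHF, hHrec⟩ := aux_green U δ what V M c z₀ hδ0 hc hV0 hVM hw0 hw1 hLw qhat hqhat0
    hqhats Ghat hGhat
  have hgF : ∀ F : Finset (Fin d → ℤ), ∑ z ∈ F, (if z ∈ U then g z else 0) ≤ M / c := by
    intro F
    have hi : ∀ z ∈ F, Integrable (fun η => if z ∈ U then G η z else 0) μ := by
      intro z _
      split_ifs
      · exact hGint z
      · exact integrable_zero _ _ _
    have e : ∑ z ∈ F, (if z ∈ U then g z else 0)
        = ∫ η, ∑ z ∈ F, (if z ∈ U then G η z else 0) ∂μ := by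
      rw [integral_finsetSum _ hi]
      refine Finset.sum_congr rfl fun z _ => ?_
      split_ifs
      · rfl
      · simp
    rw [e]
    calc _ ≤ ∫ _, M / c ∂μ := integral_mono (integrable_finsetSum _ hi) (integrable_const _)
          fun η => (hgr η).2.1 F
      _ = M / c := by simp
  have hgrec : ∀ z, g z = (if z = z₀ then 1 else 0) + δ * ∑ u, if z - step d u ∈ U then
      what (z - step d u) u * g (z - step d u) else 0 := by
    intro z
    have hi : ∀ u ∈ Finset.univ, Integrable (fun η => if z - step d u ∈ U then
        ω η (z - step d u) u * G η (z - step d u) else 0) μ := by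
      intro u _
      split_ifs
      · simpa only [mul_comm] using hGωint (z - step d u) u
      · exact integrable_zero _ _ _
    have e : g z = ∫ η, ((if z = z₀ then 1 else 0) + δ * ∑ u, if z - step d u ∈ U then
        ω η (z - step d u) u * G η (z - step d u) else 0) ∂μ :=
      integral_congr_ae (Filter.Eventually.of_forall fun η => (hgr η).2.2 z)
    rw [e, integral_add (integrable_const _) ((integrable_finsetSum _ hi).const_mul _),
      integral_const_mul, integral_finsetSum _ hi]
    congr 1
    · simp
    · congr 1
      refine Finset.sum_congr rfl fun u _ => ?_
      split_ifs
      · rw [hwg]; simp only [mul_comm]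
      · simp
  have hgs : Summable fun z => if z ∈ U then g z else 0 :=
    summable_of_sum_le (fun z => by have := hg0 z; simp only [Pi.zero_apply]; split_ifs <;> positivity) hgF
  have hHs : Summable fun z => if z ∈ U then Ghat z else 0 :=
    summable_of_sum_le (fun z => by have := hH0 z; simp only [Pi.zero_apply]; split_ifs <;> positivity) hHF
  have hfin := aux_unique U δ what V M c hδ0 hc hV0 hVM hw0 hw1 hLw (fun z => g z - Ghat z)
    (by
      refine Summable.of_nonneg_of_le (fun x => ?_) (fun x => ?_) (hgs.add hHs)
      · split_ifs <;> positivity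
      · split_ifs
        · have h1 := hg0 x
          have h2 := hH0 x
          rw [abs_le]; constructor <;> linarith
        · simp)
    (by
      intro z
      rw [hgrec z, hHrec z, add_sub_add_left_eq_sub, ← mul_sub, ← Finset.sum_sub_distrib]
      congr 1
      refine Finset.sum_congr rfl fun u _ => ?_
      split_ifs
      · ring
      · ring) z
  exact sub_eq_zero.mp hfin
end

section
/- Perturbation estimate for Green functions (first order): let ω, ω' ∈ Ω_{κ₀} agree everywhere except at one site z, with ω'(z,e) = ω(z,e) + Δω(e) and Σ_e Δω(e) = 0. Then for U ∋ z (U bounded or δ < 1), all y ∈ U, y' ∈ U ∪ ∂U: |G_{U,δ}^{ω'}(y,y') - G_{U,δ}^ω(y,y')| ≤ (2d sup_e |Δω(e)| / κ₀²) · G_{U,δ}^{ω'}(y,y'). -/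
open Classical in
/-- One forward step of the walk with steps started only in `V`. -/
noncomputable def stepOp {d : ℕ} (V : Set (Fin d → ℤ)) (ω : (Fin d → ℤ) → Fin d × Bool → ℝ) :
    ((Fin d → ℤ) → ℝ) →ₗ[ℝ] ((Fin d → ℤ) → ℝ) where
  toFun f := fun x => ∑ u, if x - step d u ∈ V then ω (x - step d u) u * f (x - step d u) else 0
  map_add' f g := by
    funext x
    simp only [Pi.add_apply, ← Finset.sum_add_distrib]
    refine Finset.sum_congr rfl fun u _ => ?_
    split_ifs <;> ring
  map_smul' c f := by
    funext x
    simp only [Pi.smul_apply, smul_eq_mul, RingHom.id_apply, Finset.mul_sum]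
    refine Finset.sum_congr rfl fun u _ => ?_
    split_ifs <;> ring

open Classical in
theorem stepOp_apply {d : ℕ} (V : Set (Fin d → ℤ)) (ω : (Fin d → ℤ) → Fin d × Bool → ℝ)
    (f : (Fin d → ℤ) → ℝ) (x : Fin d → ℤ) :
    stepOp V ω f x =
      ∑ u, if x - step d u ∈ V then ω (x - step d u) u * f (x - step d u) else 0 := rfl

/-- indicator of a point -/
def ind {d : ℕ} (y : Fin d → ℤ) : (Fin d → ℤ) → ℝ := fun x => if x = y then 1 else 0

open Classical in
theorem stepOp_ind {d : ℕ} (V : Set (Fin d → ℤ)) (ω : (Fin d → ℤ) → Fin d × Bool → ℝ)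
    (x : Fin d → ℤ) :
    stepOp V ω (ind x) = if x ∈ V then ∑ u, ω x u • ind (x + step d u) else 0 := by
  funext w
  rw [stepOp_apply]
  by_cases hx : x ∈ V
  · simp only [hx, if_true, Finset.sum_apply, Pi.smul_apply, smul_eq_mul, ind]
    refine Finset.sum_congr rfl fun u _ => ?_
    by_cases h : w = x + step d u
    · subst h; simp [hx]
    · have h' : w - step d u ≠ x := fun e => h (by rw [← e]; simp)
      simp [h, h']
  · simp only [hx, if_false, Pi.zero_apply, ind]
    refine Finset.sum_eq_zero fun u _ => ?_
    by_cases h : w - step d u = x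
    · simp [h, hx]
    · simp [h]

/-- weight of `n`-step paths from `x` to `w` -/
noncomputable def gk {d : ℕ} (V : Set (Fin d → ℤ)) (ω : (Fin d → ℤ) → Fin d × Bool → ℝ)
    (n : ℕ) (x w : Fin d → ℤ) : ℝ := ((stepOp V ω) ^ n) (ind x) w

theorem gk_zero {d : ℕ} (V : Set (Fin d → ℤ)) (ω : (Fin d → ℤ) → Fin d × Bool → ℝ)
    (x w : Fin d → ℤ) : gk V ω 0 x w = if w = x then 1 else 0 := by
  simp [gk, ind]

open Classical in
theorem gk_succ {d : ℕ} (V : Set (Fin d → ℤ)) (ω : (Fin d → ℤ) → Fin d × Bool → ℝ)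
    (n : ℕ) (x w : Fin d → ℤ) :
    gk V ω (n + 1) x w = if x ∈ V then ∑ u, ω x u * gk V ω n (x + step d u) w else 0 := by
  unfold gk
  rw [pow_succ, Module.End.mul_apply, stepOp_ind]
  split_ifs
  · simp [map_sum]
  · simp

theorem gk_nonneg {d : ℕ} (V : Set (Fin d → ℤ)) (ω : (Fin d → ℤ) → Fin d × Bool → ℝ)
    (h0 : ∀ x u, 0 ≤ ω x u) (n : ℕ) (x w : Fin d → ℤ) : 0 ≤ gk V ω n x w := by
  induction n generalizing x with
  | zero => rw [gk_zero]; split_ifs <;> norm_num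
  | succ n ih =>
    rw [gk_succ]; split_ifs
    · exact Finset.sum_nonneg fun u _ => mul_nonneg (h0 _ _) (ih _)
    · exact le_rfl

theorem avg_le {d : ℕ} {p : Fin d × Bool → ℝ} (h0 : ∀ u, 0 ≤ p u) (h1 : ∑ u, p u = 1)
    {f : Fin d × Bool → ℝ} {c : ℝ} (hf : ∀ u, f u ≤ c) : ∑ u, p u * f u ≤ c := by
  calc ∑ u, p u * f u ≤ ∑ u, p u * c :=
        Finset.sum_le_sum fun u _ => mul_le_mul_of_nonneg_left (hf u) (h0 u)
    _ = c := by rw [← Finset.sum_mul, h1, one_mul]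

theorem gk_le_one {d : ℕ} (V : Set (Fin d → ℤ)) (ω : (Fin d → ℤ) → Fin d × Bool → ℝ)
    (h0 : ∀ x u, 0 ≤ ω x u) (h1 : ∀ x, ∑ u, ω x u = 1)
    (n : ℕ) (x w : Fin d → ℤ) : gk V ω n x w ≤ 1 := by
  induction n generalizing x with
  | zero => rw [gk_zero]; split_ifs <;> norm_num
  | succ n ih =>
    rw [gk_succ]; split_ifs
    · exact avg_le (h0 x) (h1 x) fun u => ih _
    · exact zero_le_one

open Classical in
theorem gk_sum_succ {d : ℕ} (V : Set (Fin d → ℤ)) (ω : (Fin d → ℤ) → Fin d × Bool → ℝ)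
    (N : ℕ) (x w : Fin d → ℤ) :
    ∑ n ∈ Finset.range (N + 1), gk V ω n x w = (if w = x then 1 else 0) +
      if x ∈ V then ∑ u, ω x u * ∑ n ∈ Finset.range N, gk V ω n (x + step d u) w else 0 := by
  rw [Finset.sum_range_succ', gk_zero, add_comm]
  congr 1
  simp only [gk_succ]
  split_ifs
  · rw [Finset.sum_comm]; simp only [Finset.mul_sum]
  · simp

/-- a Lyapunov function for finite sets -/
theorem exists_lyapunov {d : ℕ} (hd : 0 < d) {κ : ℝ} (hκ : 0 < κ)
    (V : Set (Fin d → ℤ)) (hV : V.Finite) (ω : (Fin d → ℤ) → Fin d × Bool → ℝ)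
    (hω : ∀ x u, κ ≤ ω x u) (h1 : ∀ x, ∑ u, ω x u = 1) :
    ∃ φ : (Fin d → ℤ) → ℝ, (∀ x, 0 ≤ φ x) ∧
      ∀ x ∈ V, 1 + ∑ u, ω x u * φ (x + step d u) ≤ φ x := by
  let i0 : Fin d := ⟨0, hd⟩
  set l : ℝ := 1 + 2 / κ with hl
  have hl1 : 1 < l := by rw [hl]; have : 0 < 2 / κ := by positivity
                         linarith
  have hl0 : 0 < l := by linarith
  obtain ⟨M0, hM0⟩ := (hV.image fun x => l ^ (- x i0)).bddAbove
  set M := max M0 0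
  have hM' : 0 ≤ M := le_max_right _ _
  have hM : ∀ x ∈ V, 1 ≤ M * l ^ (x i0) := fun x hx => by
    have h : l ^ (- x i0) ≤ M := (hM0 (Set.mem_image_of_mem _ hx)).trans (le_max_left _ _)
    have hp : 0 < l ^ (x i0) := zpow_pos hl0 _
    calc (1:ℝ) = l ^ (- x i0) * l ^ (x i0) := by
          rw [zpow_neg, inv_mul_cancel₀ hp.ne']
      _ ≤ _ := mul_le_mul_of_nonneg_right h hp.le
  obtain ⟨C, hC⟩ := (hV.image fun x => M * l ^ (x i0 + 1)).bddAbove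
  have hC' : ∀ x ∈ V, ∀ k : ℤ, k ≤ 1 → M * l ^ (x i0 + k) ≤ C := fun x hx k hk => by
    refine le_trans ?_ (hC (Set.mem_image_of_mem _ hx))
    exact mul_le_mul_of_nonneg_left (zpow_le_zpow_right₀ hl1.le (by lia)) hM'
  have hstep : ∀ u : Fin d × Bool, step d u i0 ≤ 1 := fun u => by
    unfold step
    rw [Pi.single_apply]
    split_ifs <;> norm_num
  refine ⟨fun x => max (C - M * l ^ (x i0)) 0, fun x => le_max_right _ _, fun x hx => ?_⟩
  have e1 : max (C - M * l ^ (x i0)) 0 = C - M * l ^ (x i0) := by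
    apply max_eq_left
    have := hC' x hx 0 (by norm_num)
    rw [add_zero] at this; linarith
  have e2 : ∀ u, max (C - M * l ^ ((x + step d u) i0)) 0 = C - M * l ^ (x i0 + step d u i0) := by
    intro u
    apply max_eq_left
    have := hC' x hx _ (hstep u)
    rw [Pi.add_apply]; linarith
  simp only [e1, e2, mul_sub, Finset.sum_sub_distrib, ← Finset.sum_mul, h1, one_mul]
  -- now lower bound of the average of the exponential
  have hpw : ∀ u, l ^ (x i0 + step d u i0) = l ^ (x i0) * l ^ (step d u i0) := fun u =>
    zpow_add₀ hl0.ne' _ _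
  have hX := hM x hx
  set X := l ^ (x i0)
  have key : (2:ℝ) ≤ ∑ u, ω x u * l ^ (step d u i0) := by
    have hs : ∀ u, (0:ℝ) ≤ l ^ (step d u i0) := fun u => (zpow_pos hl0 _).le
    have hbig : ∀ u, ω x u * (if u = (i0, true) then l - 1 else 0)
        - (if u = (i0, false) then ω x u else 0) + ω x u
         ≤ ω x u * l ^ (step d u i0) := by
      intro u
      have hwu : 0 ≤ ω x u := hκ.le.trans (hω x u)
      obtain ⟨i, b⟩ := u
      by_cases hi : i = i0
      · subst hi
        cases b
        · have := mul_nonneg hwu (hs (i0, false))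
          simpa using this
        · simp [step]; ring_nf; rfl
      · have : step d (i, b) i0 = 0 := by
          simp [step, Pi.single_apply, Ne.symm hi]
        simp [this, hi]
    have := Finset.sum_le_sum fun u (_ : u ∈ Finset.univ) => hbig u
    refine le_trans ?_ this
    rw [Finset.sum_add_distrib, Finset.sum_sub_distrib, h1]
    simp only [mul_ite, mul_zero, Finset.sum_ite_eq', Finset.mem_univ, if_true]
    have ha := hω x (i0, true)
    have hb : ω x (i0, false) + ω x (i0, true) ≤ 1 := by
      rw [← h1 x, ← Finset.sum_pair (by simp : ((i0, false) : Fin d × Bool) ≠ (i0, true))]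
      exact Finset.sum_le_sum_of_subset_of_nonneg (Finset.subset_univ _)
        fun u _ _ => hκ.le.trans (hω x u)
    have h2 : κ * (l - 1) = 2 := by rw [hl]; field_simp; ring
    have h3 : κ * (l - 1) ≤ ω x (i0, true) * (l - 1) :=
      mul_le_mul_of_nonneg_right ha (by linarith)
    linarith
  have hsum : ∑ u, ω x u * (M * l ^ (x i0 + step d u i0))
      = M * X * ∑ u, ω x u * l ^ (step d u i0) := by
    rw [Finset.mul_sum]
    refine Finset.sum_congr rfl fun u _ => ?_
    rw [hpw]; ring
  rw [hsum]
  nlinarith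

theorem gk_summable {d : ℕ} (hd : 0 < d) {κ : ℝ} (hκ : 0 < κ)
    (V : Set (Fin d → ℤ)) (ω : (Fin d → ℤ) → Fin d × Bool → ℝ)
    (hω : ∀ x u, κ ≤ ω x u) (h1 : ∀ x, ∑ u, ω x u = 1)
    {δ : ℝ} (hδ0 : 0 < δ) (hδ1 : δ ≤ 1) (hV : V.Finite ∨ δ < 1) (x w : Fin d → ℤ) :
    Summable fun n => δ ^ n * gk V ω n x w := by
  have h0 : ∀ x u, 0 ≤ ω x u := fun x u => hκ.le.trans (hω x u)
  rcases hV with hV | hδ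
  · have : Summable fun n => gk V ω n x w := by
      obtain ⟨φ, hφ0, hφ⟩ := exists_lyapunov hd hκ V hV ω hω h1
      refine summable_of_sum_range_le (c := 1 + φ x) (fun n => gk_nonneg V ω h0 n x w) fun N => ?_
      induction N generalizing x with
      | zero => simpa using add_nonneg zero_le_one (hφ0 x)
      | succ N ih =>
        rw [gk_sum_succ]
        have hi : (if w = x then (1:ℝ) else 0) ≤ 1 := by split_ifs <;> norm_num
        by_cases hx : x ∈ V
        · rw [if_pos hx]
          have h2 : ∑ u, ω x u * ∑ n ∈ Finset.range N, gk V ω n (x + step d u) w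
              ≤ ∑ u, ω x u * (1 + φ (x + step d u)) :=
            Finset.sum_le_sum fun u _ => mul_le_mul_of_nonneg_left (ih _) (h0 x u)
          have h3 := hφ x hx
          simp only [mul_add, mul_one, Finset.sum_add_distrib, h1] at h2
          linarith
        · rw [if_neg hx]
          linarith [hφ0 x]
    refine Summable.of_nonneg_of_le (fun n => mul_nonneg (by positivity) (gk_nonneg V ω h0 n x w))
      (fun n => ?_) this
    exact mul_le_of_le_one_left (gk_nonneg V ω h0 n x w) (pow_le_one₀ hδ0.le hδ1)
  · refine Summable.of_nonneg_of_le (fun n => mul_nonneg (by positivity) (gk_nonneg V ω h0 n x w))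
      (fun n => ?_) (summable_geometric_of_lt_one hδ0.le hδ)
    exact mul_le_of_le_one_right (by positivity) (gk_le_one V ω h0 h1 n x w)

/-- hitting weights are at most one -/
theorem gk_hit_le_one {d : ℕ}
    (V : Set (Fin d → ℤ)) (ω : (Fin d → ℤ) → Fin d × Bool → ℝ)
    (h0 : ∀ x u, 0 ≤ ω x u) (h1 : ∀ x, ∑ u, ω x u = 1)
    {δ : ℝ} (hδ0 : 0 < δ) (hδ1 : δ ≤ 1) (x z : Fin d → ℤ) (hz : z ∉ V) :
    ∑' n, δ ^ n * gk V ω n x z ≤ 1 := by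
  refine Real.tsum_le_of_sum_range_le
    (fun n => mul_nonneg (by positivity) (gk_nonneg V ω h0 n x z)) fun N => ?_
  have : ∑ n ∈ Finset.range N, gk V ω n x z ≤ 1 := by
    induction N generalizing x with
    | zero => simp
    | succ N ih =>
      rw [gk_sum_succ]
      by_cases hx : x ∈ V
      · have : z ≠ x := fun h => hz (h ▸ hx)
        rw [if_pos hx, if_neg this, zero_add]
        exact avg_le (h0 x) (h1 x) fun u => ih _
      · rw [if_neg hx]; split_ifs <;> norm_num
  refine le_trans (Finset.sum_le_sum fun n _ => ?_) this
  exact mul_le_of_le_one_left (gk_nonneg V ω h0 n x z) (pow_le_one₀ hδ0.le hδ1)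

theorem stepOp_split {d : ℕ} (U : Set (Fin d → ℤ)) (ω : (Fin d → ℤ) → Fin d × Bool → ℝ)
    (z : Fin d → ℤ) (hz : z ∈ U) (f : (Fin d → ℤ) → ℝ) :
    stepOp U ω f = stepOp (U \ {z}) ω f + f z • ∑ u, ω z u • ind (z + step d u) := by
  funext x
  simp only [Pi.add_apply, Pi.smul_apply, Finset.sum_apply, smul_eq_mul, stepOp_apply,
    Finset.mul_sum, ← Finset.sum_add_distrib, ind]
  refine Finset.sum_congr rfl fun u _ => ?_
  by_cases h : x - step d u = z
  · have h' : x = z + step d u := by rw [← h]; simp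
    subst h'
    simp [hz, mul_comm]
  · have h' : x ≠ z + step d u := fun e => h (by rw [e]; simp)
    have h2 : (x - step d u ∈ U \ {z}) ↔ x - step d u ∈ U := ⟨fun a => a.1, fun a => ⟨a, h⟩⟩
    rw [if_neg h', mul_zero, mul_zero, add_zero]
    by_cases hU : x - step d u ∈ U
    · rw [if_pos hU, if_pos (h2.2 hU)]
    · rw [if_neg hU, if_neg (fun a => hU (h2.1 a))]

theorem gk_renewal {d : ℕ} (U : Set (Fin d → ℤ)) (ω : (Fin d → ℤ) → Fin d × Bool → ℝ)
    (z : Fin d → ℤ) (hz : z ∈ U) (n : ℕ) (y w : Fin d → ℤ) :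
    gk U ω (n + 1) y w = gk (U \ {z}) ω (n + 1) y w +
      ∑ m ∈ Finset.range (n + 1), gk U ω m y z *
        ∑ u, ω z u * gk (U \ {z}) ω (n - m) (z + step d u) w := by
  have hvec : ∀ n : ℕ, ((stepOp U ω) ^ (n + 1)) (ind y) = ((stepOp (U \ {z}) ω) ^ (n + 1)) (ind y) +
      ∑ m ∈ Finset.range (n + 1), gk U ω m y z •
        ((stepOp (U \ {z}) ω) ^ (n - m)) (∑ u, ω z u • ind (z + step d u)) := by
    intro n
    induction n with
    | zero =>
      simp only [zero_add, pow_one, Finset.sum_range_one, pow_zero, Nat.sub_self]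
      rw [stepOp_split U ω z hz]
      simp [gk]
    | succ n ih =>
      rw [pow_succ', Module.End.mul_apply, stepOp_split U ω z hz, Finset.sum_range_succ, ih, map_add,
        map_sum, pow_succ' _ (n + 1), Module.End.mul_apply, add_assoc]
      congr 1
      rw [← ih]
      congr 1
      · refine Finset.sum_congr rfl fun m hm => ?_
        have : n + 1 - m = (n - m) + 1 := by
          have := Finset.mem_range.1 hm
          lia
        rw [this, pow_succ', Module.End.mul_apply, map_smul]
      · simp [gk]
  have := congrFun (hvec n) w
  unfold gk at this ⊢
  rw [this]
  simp [map_sum, Finset.sum_apply]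

/-- the Green function -/
noncomputable def gr {d : ℕ} (V : Set (Fin d → ℤ)) (ω : (Fin d → ℤ) → Fin d × Bool → ℝ)
    (δ : ℝ) (x w : Fin d → ℤ) : ℝ := ∑' n, δ ^ n * gk V ω n x w

theorem gr_renewal {d : ℕ} (hd : 0 < d) {κ : ℝ} (hκ : 0 < κ)
    (U : Set (Fin d → ℤ)) (ω : (Fin d → ℤ) → Fin d × Bool → ℝ)
    (hω : ∀ x u, κ ≤ ω x u) (h1 : ∀ x, ∑ u, ω x u = 1)
    {δ : ℝ} (hδ0 : 0 < δ) (hδ1 : δ ≤ 1) (hU : U.Finite ∨ δ < 1)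
    (z : Fin d → ℤ) (hz : z ∈ U) (y w : Fin d → ℤ) :
    gr U ω δ y w = gr (U \ {z}) ω δ y w +
      gr U ω δ y z * (δ * ∑ u, ω z u * gr (U \ {z}) ω δ (z + step d u) w) := by
  have h0 : ∀ x u, 0 ≤ ω x u := fun x u => hκ.le.trans (hω x u)
  have hV : (U \ {z}).Finite ∨ δ < 1 := hU.imp (fun h => h.subset Set.sdiff_subset) id
  have sU := gk_summable hd hκ U ω hω h1 hδ0 hδ1 hU
  have sV := gk_summable hd hκ (U \ {z}) ω hω h1 hδ0 hδ1 hV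
  have hr : ∑ u, ω z u * gr (U \ {z}) ω δ (z + step d u) w =
      ∑' n, δ ^ n * ∑ u, ω z u * gk (U \ {z}) ω n (z + step d u) w := by
    have : ∀ n, δ ^ n * ∑ u, ω z u * gk (U \ {z}) ω n (z + step d u) w =
        ∑ u, ω z u * (δ ^ n * gk (U \ {z}) ω n (z + step d u) w) := fun n => by
      rw [Finset.mul_sum]
      exact Finset.sum_congr rfl fun u _ => by ring
    simp only [this]
    rw [Summable.tsum_finsetSum fun u _ => (sV _ _).mul_left _]
    simp only [tsum_mul_left, gr]
  have sr : Summable fun n => δ ^ n * ∑ u, ω z u * gk (U \ {z}) ω n (z + step d u) w := by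
    have : ∀ n, δ ^ n * ∑ u, ω z u * gk (U \ {z}) ω n (z + step d u) w =
        ∑ u, ω z u * (δ ^ n * gk (U \ {z}) ω n (z + step d u) w) := fun n => by
      rw [Finset.mul_sum]
      exact Finset.sum_congr rfl fun u _ => by ring
    simp only [this]
    exact summable_sum fun u _ => (sV _ _).mul_left _
  have nU : ∀ n, 0 ≤ δ ^ n * gk U ω n y z := fun n =>
    mul_nonneg (by positivity) (gk_nonneg U ω h0 n y z)
  have nr : ∀ n, 0 ≤ δ ^ n * ∑ u, ω z u * gk (U \ {z}) ω n (z + step d u) w := fun n =>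
    mul_nonneg (by positivity) (Finset.sum_nonneg fun u _ =>
      mul_nonneg (h0 _ _) (gk_nonneg _ ω h0 _ _ _))
  have cau := tsum_mul_tsum_eq_tsum_sum_range_of_summable_norm
    (sU y z).norm sr.norm
  have scau := (summable_norm_sum_mul_range_of_summable_norm (sU y z).norm sr.norm).of_norm
  rw [hr, mul_left_comm]
  unfold gr
  rw [cau, (sU y w).tsum_eq_zero_add, (sV y w).tsum_eq_zero_add, ← tsum_mul_left, add_assoc,
    ← Summable.tsum_add ((summable_nat_add_iff 1).2 (sV y w)) (scau.mul_left δ)]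
  congr 1
  refine tsum_congr fun n => ?_
  rw [gk_renewal U ω z hz, mul_add, Finset.mul_sum, Finset.mul_sum]
  congr 1
  refine Finset.sum_congr rfl fun m hm => ?_
  have e : δ ^ (n + 1) = δ * (δ ^ m * δ ^ (n - m)) := by
    rw [← pow_add, ← pow_succ']
    congr 1
    have := Finset.mem_range.1 hm
    lia
  rw [e]; ring

theorem final_algebra {ι : Type*} [Fintype ι] (κ ε δ D : ℝ) (hκ : 0 < κ) (hD : 1 + κ ≤ D)
    (hδ0 : 0 < δ) (hδ1 : δ ≤ 1) (p p' h A : ι → ℝ)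
    (hp : ∀ u, κ ≤ p u) (hp' : ∀ u, κ ≤ p' u) (hp1 : ∑ u, p u = 1) (hp'1 : ∑ u, p' u = 1)
    (hε : ∀ u, |p' u - p u| ≤ ε) (hε0 : 0 ≤ ε) (hh1 : ∀ u, h u ≤ 1)
    (hA : ∀ u, 0 ≤ A u) (g a Gz Gz' Gw Gw' : ℝ) (hg : 0 ≤ g) (hGz' : 0 ≤ Gz')
    (hH : δ * ∑ u, p u * h u < 1)
    (e1 : Gz = a + Gz * (δ * ∑ u, p u * h u)) (e1' : Gz' = a + Gz' * (δ * ∑ u, p' u * h u))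
    (e2 : Gw = g + Gz * (δ * ∑ u, p u * A u)) (e2' : Gw' = g + Gz' * (δ * ∑ u, p' u * A u)) :
    |Gw' - Gw| ≤ D * ε / κ ^ 2 * Gw' := by
  set H := δ * ∑ u, p u * h u with hHd
  set H' := δ * ∑ u, p' u * h u with hHd'
  set B := δ * ∑ u, p u * A u with hBd
  set B' := δ * ∑ u, p' u * A u with hBd'
  have hHH : |H' - H| ≤ ε / κ * (1 - H) := by
    have x1 : H' - H = δ * ∑ u, (p' u - p u) * (h u - 1) := by
      simp only [mul_sub, sub_mul, mul_one, Finset.sum_sub_distrib, hp1, hp'1, hHd, hHd']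
      ring
    have x2 : |∑ u, (p' u - p u) * (h u - 1)| ≤ ∑ u, ε / κ * (p u * (1 - h u)) := by
      refine (Finset.abs_sum_le_sum_abs _ _).trans (Finset.sum_le_sum fun u _ => ?_)
      rw [abs_mul, abs_sub_comm (h u), abs_of_nonneg (sub_nonneg.2 (hh1 u)), ← mul_assoc]
      refine mul_le_mul_of_nonneg_right ((hε u).trans ?_) (sub_nonneg.2 (hh1 u))
      rw [div_mul_eq_mul_div, le_div_iff₀ hκ]
      exact mul_le_mul_of_nonneg_left (hp u) hε0
    rw [x1, abs_mul, abs_of_pos hδ0]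
    rw [← Finset.mul_sum] at x2
    have x3 : ∑ u, p u * (1 - h u) = 1 - ∑ u, p u * h u := by
      simp only [mul_sub, mul_one, Finset.sum_sub_distrib, hp1]
    rw [x3] at x2
    calc _ ≤ δ * (ε / κ * (1 - ∑ u, p u * h u)) := mul_le_mul_of_nonneg_left x2 hδ0.le
      _ = ε / κ * (δ - H) := by rw [hHd]; ring
      _ ≤ _ := mul_le_mul_of_nonneg_left (by linarith) (by positivity)
  have hBnn : 0 ≤ B := mul_nonneg hδ0.le
    (Finset.sum_nonneg fun u _ => mul_nonneg (hκ.le.trans (hp u)) (hA u))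
  have hBnn' : 0 ≤ B' := mul_nonneg hδ0.le
    (Finset.sum_nonneg fun u _ => mul_nonneg (hκ.le.trans (hp' u)) (hA u))
  have hBB : |B' - B| ≤ ε / κ * B' := by
    have x1 : B' - B = δ * ∑ u, (p' u - p u) * A u := by
      simp only [sub_mul, Finset.sum_sub_distrib, hBd, hBd']
      ring
    have x2 : |∑ u, (p' u - p u) * A u| ≤ ∑ u, ε / κ * (p' u * A u) := by
      refine (Finset.abs_sum_le_sum_abs _ _).trans (Finset.sum_le_sum fun u _ => ?_)
      rw [abs_mul, abs_of_nonneg (hA u), ← mul_assoc]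
      refine mul_le_mul_of_nonneg_right ((hε u).trans ?_) (hA u)
      rw [div_mul_eq_mul_div, le_div_iff₀ hκ]
      exact mul_le_mul_of_nonneg_left (hp' u) hε0
    rw [x1, abs_mul, abs_of_pos hδ0]
    rw [← Finset.mul_sum] at x2
    calc _ ≤ δ * (ε / κ * (∑ u, p' u * A u)) := mul_le_mul_of_nonneg_left x2 hδ0.le
      _ = _ := by rw [hBd']; ring
  have hBle : B ≤ B' / κ := by
    rw [le_div_iff₀ hκ, hBd, hBd', mul_assoc]
    refine mul_le_mul_of_nonneg_left ?_ hδ0.le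
    rw [Finset.sum_mul]
    refine Finset.sum_le_sum fun u _ => ?_
    have : p u ≤ 1 := by
      rw [← hp1]
      exact Finset.single_le_sum (f := p) (fun v _ => hκ.le.trans (hp v)) (Finset.mem_univ u)
    have := hA u
    have := hp' u
    calc p u * A u * κ ≤ 1 * A u * κ := by gcongr
      _ = κ * A u := by ring
      _ ≤ p' u * A u := by gcongr
  have hGG : |Gz' - Gz| ≤ ε / κ * Gz' := by
    have x : (Gz' - Gz) * (1 - H) = Gz' * (H' - H) := by linarith
    have hpos : 0 < 1 - H := by linarith
    have x2 : |Gz' - Gz| * (1 - H) ≤ ε / κ * Gz' * (1 - H) := by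
      rw [← abs_of_pos hpos, ← abs_mul, x, abs_mul, abs_of_nonneg hGz', abs_of_pos hpos]
      calc _ ≤ Gz' * (ε / κ * (1 - H)) := mul_le_mul_of_nonneg_left hHH hGz'
        _ = _ := by ring
    exact le_of_mul_le_mul_right x2 hpos
  have x : Gw' - Gw = Gz' * (B' - B) + (Gz' - Gz) * B := by rw [e2, e2']; ring
  have hfin : Gz' * B' ≤ Gw' := by linarith
  have hD0 : 0 ≤ D := by linarith
  have hc : 0 ≤ D * ε / κ ^ 2 := by positivity
  calc |Gw' - Gw| ≤ Gz' * |B' - B| + |Gz' - Gz| * B := by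
        rw [x]
        refine (abs_add_le _ _).trans ?_
        rw [abs_mul, abs_mul, abs_of_nonneg hGz', abs_of_nonneg hBnn]
    _ ≤ Gz' * (ε / κ * B') + ε / κ * Gz' * (B' / κ) := by gcongr
    _ = (1 + κ) * ε / κ ^ 2 * (Gz' * B') := by field_simp; ring
    _ ≤ D * ε / κ ^ 2 * Gw' := by gcongr

/-- First-order perturbation estimate for Green functions: if `ω, ω' ∈ Ω_{κ₀}`
agree except at one site `z ∈ U`, then for all `y ∈ U`, `y' ∈ U ∪ ∂U`,
`|G'_{U,δ}(y,y') - G_{U,δ}(y,y')| ≤ (2d sup_e |Δω(e)| / κ₀²) G'_{U,δ}(y,y')`. -/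
theorem stmt16 (d : ℕ) (hd : 0 < d) (κ₀ : ℝ) (hκ : 0 < κ₀)
    (ω ω' : (Fin d → ℤ) → Fin d × Bool → ℝ)
    (hω : ∀ x u, κ₀ ≤ ω x u) (hω1 : ∀ x, ∑ u, ω x u = 1)
    (hω' : ∀ x u, κ₀ ≤ ω' x u) (hω'1 : ∀ x, ∑ u, ω' x u = 1)
    (z : Fin d → ℤ) (hagree : ∀ y, y ≠ z → ω' y = ω y)
    (hΔsum : ∑ u, (ω' z u - ω z u) = 0)
    (U : Set (Fin d → ℤ)) [DecidablePred (· ∈ U)] (hz : z ∈ U)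
    (δ : ℝ) (hδ0 : 0 < δ) (hδ1 : δ ≤ 1) (hUδ : U.Finite ∨ δ < 1)
    (y : Fin d → ℤ) (hy : y ∈ U)
    (y' : Fin d → ℤ)
    (hy' : y' ∈ U ∪ {x : Fin d → ℤ | x ∉ U ∧ ∃ u, x + step d u ∈ U})
    (q q' : ℕ → (Fin d → ℤ) → ℝ)
    (hq0 : ∀ x, q 0 x = if x = y then 1 else 0)
    (hqs : ∀ n x, q (n + 1) x =
      ∑ u, if x - step d u ∈ U then ω (x - step d u) u * q n (x - step d u) else 0)
    (hq'0 : ∀ x, q' 0 x = if x = y then 1 else 0)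
    (hq's : ∀ n x, q' (n + 1) x =
      ∑ u, if x - step d u ∈ U then ω' (x - step d u) u * q' n (x - step d u) else 0)
    (G G' : (Fin d → ℤ) → ℝ)
    (hG : ∀ x, G x = ∑' n : ℕ, δ ^ n * q n x)
    (hG' : ∀ x, G' x = ∑' n : ℕ, δ ^ n * q' n x) :
    |G' y' - G y'|
      ≤ 2 * d * (⨆ u : Fin d × Bool, |ω' z u - ω z u|) / κ₀ ^ 2 * G' y' := by
  have h0 : ∀ x u, 0 ≤ ω x u := fun x u => hκ.le.trans (hω x u)
  have h0' : ∀ x u, 0 ≤ ω' x u := fun x u => hκ.le.trans (hω' x u)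
  have hqg : ∀ n x, q n x = gk U ω n y x := by
    intro n
    induction n with
    | zero => intro x; rw [hq0, gk_zero]
    | succ n ih =>
      intro x
      rw [hqs, gk, pow_succ', Module.End.mul_apply, stepOp_apply]
      refine Finset.sum_congr rfl fun u _ => ?_
      split_ifs
      · rw [ih]; rfl
      · rfl
  have hqg' : ∀ n x, q' n x = gk U ω' n y x := by
    intro n
    induction n with
    | zero => intro x; rw [hq'0, gk_zero]
    | succ n ih =>
      intro x
      rw [hq's, gk, pow_succ', Module.End.mul_apply, stepOp_apply]
      refine Finset.sum_congr rfl fun u _ => ?_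
      split_ifs
      · rw [ih]; rfl
      · rfl
  have hGg : G y' = gr U ω δ y y' := by rw [hG]; simp only [hqg]; rfl
  have hGg' : G' y' = gr U ω' δ y y' := by rw [hG']; simp only [hqg']; rfl
  have hop : stepOp (U \ {z}) ω' = stepOp (U \ {z}) ω := by
    refine LinearMap.ext fun f => funext fun x => ?_
    rw [stepOp_apply, stepOp_apply]
    refine Finset.sum_congr rfl fun u _ => ?_
    split_ifs with h
    · rw [hagree _ h.2]
    · rfl
  have hgr : ∀ x w, gr (U \ {z}) ω' δ x w = gr (U \ {z}) ω δ x w := by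
    intro x w; simp only [gr, gk, hop]
  have nn : ∀ x w, 0 ≤ gr (U \ {z}) ω δ x w := fun x w =>
    tsum_nonneg fun n => mul_nonneg (by positivity) (gk_nonneg _ ω h0 n x w)
  have nn' : ∀ x w, 0 ≤ gr U ω' δ x w := fun x w =>
    tsum_nonneg fun n => mul_nonneg (by positivity) (gk_nonneg _ ω' h0' n x w)
  have nnU : ∀ x w, 0 ≤ gr U ω δ x w := fun x w =>
    tsum_nonneg fun n => mul_nonneg (by positivity) (gk_nonneg _ ω h0 n x w)
  have R := gr_renewal hd hκ U ω hω hω1 hδ0 hδ1 hUδ z hz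
  have R' := gr_renewal hd hκ U ω' hω' hω'1 hδ0 hδ1 hUδ z hz
  simp only [hgr] at R'
  have hzV : z ∉ U \ {z} := fun h => h.2 rfl
  have hone : 1 ≤ gr (U \ {z}) ω δ z z := by
    have hs := gk_summable hd hκ (U \ {z}) ω hω hω1 hδ0 hδ1
      (hUδ.imp (fun h => h.subset Set.sdiff_subset) id) z z
    have := hs.le_tsum 0 fun n _ => mul_nonneg (by positivity) (gk_nonneg _ ω h0 n z z)
    simpa [gk_zero, gr] using this
  have hH : δ * ∑ u, ω z u * gr (U \ {z}) ω δ (z + step d u) z < 1 := by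
    have := R z z
    by_contra! hc
    nlinarith [nnU z z]
  have hκd : 2 * d * κ₀ ≤ 1 := by
    rw [← hω1 z]
    have : ∑ _u : Fin d × Bool, κ₀ ≤ ∑ u, ω z u := Finset.sum_le_sum fun u _ => hω z u
    simp at this
    linarith
  have hd1 : (1:ℝ) ≤ d := by exact_mod_cast hd
  rw [hGg, hGg']
  refine final_algebra κ₀ _ δ (2 * d) hκ ?_ hδ0 hδ1 (ω z) (ω' z)
    (fun u => gr (U \ {z}) ω δ (z + step d u) z) (fun u => gr (U \ {z}) ω δ (z + step d u) y')
    (hω z) (hω' z) (hω1 z) (hω'1 z) ?_ ?_ ?_ (fun u => nn _ _) _ _ _ _ _ _ (nn y y') (nn' y z)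
    hH (R y z) (R' y z) (R y y') (R' y y')
  · nlinarith
  · intro u
    exact le_ciSup (f := fun u => |ω' z u - ω z u|) (Set.finite_range _).bddAbove u
  · exact Real.iSup_nonneg fun u => abs_nonneg _
  · intro u
    exact gk_hit_le_one _ ω h0 hω1 hδ0 hδ1 _ _ hzV
end
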